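/- arXiv:1205.5774 — 5 statements merged into one kernel-verified Lean document; each statement's English description precedes it below -/
import Mathlib

section
/- Let m ≥ 2 and let f ∈ C^m(𝔹), where 𝔹 is the open unit ball in R^n. Suppose that for some ε ∈ (0,1] and some integer ℓ with 0 ≤ ℓ < m one has sup_{|ω|<1, |α|=m} ε^{|α|} |∂^α f(ω)| ≤ sup_{|ω|<1, ℓ ≤ |α| < m} ε^{|α|} |∂^α f(ω)|. Then there is a constant C depending only on the dimension n and on m such that sup_{|ω|<1} |∂^α f(ω)| ≤ C ε^{−|α|} sup_{|ω|<1, |β|=ℓ} ε^{|β|} |∂^β f(ω)| for every multiindex α with ℓ ≤ |α| ≤ m. -/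
open Metric
open scoped ENNReal

/-- The mixed partial derivative of `f` (restricted to the open unit ball of `ℝ^n`)
along the coordinate directions `σ 0, …, σ (k-1)`.  For a `C^k` function these
iterated directional derivatives along basis vectors are exactly the mixed
partials `∂^α f` with `|α| = k`. -/
noncomputable def mixedPartial {n : ℕ} (k : ℕ) (σ : Fin k → Fin n)
    (f : EuclideanSpace ℝ (Fin n) → ℝ) (x : EuclideanSpace ℝ (Fin n)) : ℝ :=
  iteratedFDerivWithin ℝ k f (ball (0 : EuclideanSpace ℝ (Fin n)) 1) x
    (fun i => EuclideanSpace.single (σ i) (1 : ℝ))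

/-- `sup_{|ω|<1, |α| = k} |∂^α f(ω)|`, as an extended nonnegative real. -/
noncomputable def derivSup (n k : ℕ) (f : EuclideanSpace ℝ (Fin n) → ℝ) : ℝ≥0∞ :=
  ⨆ ω ∈ ball (0 : EuclideanSpace ℝ (Fin n)) 1, ⨆ σ : Fin k → Fin n,
    ENNReal.ofReal |mixedPartial k σ f ω|


lemma aux_oneDim (φ φ' φ'' : ℝ → ℝ) (h M0 M2 : ℝ) (hh : 0 < h)
    (h1 : ∀ t ∈ Set.Icc 0 h, HasDerivAt φ (φ' t) t)
    (h2 : ∀ t ∈ Set.Icc 0 h, HasDerivAt φ' (φ'' t) t)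
    (b0 : ∀ t ∈ Set.Icc 0 h, |φ t| ≤ M0) (b2 : ∀ t ∈ Set.Icc 0 h, |φ'' t| ≤ M2) :
    |φ' 0| ≤ 2 * M0 / h + h * M2 := by
  obtain ⟨c, hc, hce⟩ := exists_hasDerivAt_eq_slope φ φ' hh
    (fun t ht => (h1 t ht).continuousAt.continuousWithinAt)
    (fun t ht => h1 t (Set.Ioo_subset_Icc_self ht))
  have hM2 : 0 ≤ M2 := (abs_nonneg _).trans (b2 0 ⟨le_rfl, hh.le⟩)
  have hc' : |φ' c| ≤ 2 * M0 / h := by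
    rw [hce, sub_zero, abs_div, abs_of_pos hh]
    gcongr
    have := b0 0 ⟨le_rfl, hh.le⟩
    have := b0 h ⟨hh.le, le_rfl⟩
    have := abs_sub (φ h) (φ 0)
    linarith
  have hd : ‖φ' 0 - φ' c‖ ≤ M2 * ‖(0:ℝ) - c‖ :=
    (convex_Icc (0:ℝ) h).norm_image_sub_le_of_norm_hasDerivWithin_le
      (fun t ht => (h2 t ht).hasDerivWithinAt) (fun t ht => b2 t ht)
      (Set.Ioo_subset_Icc_self hc) ⟨le_rfl, hh.le⟩
  rw [Real.norm_eq_abs, Real.norm_eq_abs, zero_sub, abs_neg, abs_of_pos hc.1] at hd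
  have : M2 * c ≤ h * M2 := by rw [mul_comm]; gcongr; exact hc.2.le
  have := abs_sub_abs_le_abs_sub (φ' 0) (φ' c)
  linarith

lemma aux_lin {n : ℕ} (L : EuclideanSpace ℝ (Fin n) →L[ℝ] ℝ) (B : ℝ)
    (hB : ∀ i, |L (EuclideanSpace.single i 1)| ≤ B) (v : EuclideanSpace ℝ (Fin n))
    (hv : ‖v‖ ≤ 2) : |L v| ≤ 2 * n * B := by
  have e : v = ∑ i, v i • EuclideanSpace.single i (1:ℝ) := by
    have := (EuclideanSpace.basisFun (Fin n) ℝ).sum_repr v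
    simpa using this.symm
  have e2 : L v = ∑ i, v i * L (EuclideanSpace.single i (1:ℝ)) := by
    conv_lhs => rw [e]
    simp
  rw [e2]
  calc |∑ i, v i * L (EuclideanSpace.single i (1:ℝ))|
      ≤ ∑ i, |v i * L (EuclideanSpace.single i (1:ℝ))| := Finset.abs_sum_le_sum_abs _ _
    _ ≤ ∑ i : Fin n, 2 * B := by
        apply Finset.sum_le_sum
        intro i _
        rw [abs_mul]
        have h1 : |v i| ≤ 2 := (PiLp.norm_apply_le v i).trans hv
        exact mul_le_mul h1 (hB i) (abs_nonneg _) (by norm_num)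
    _ = 2 * n * B := by simp; ring

lemma aux_hasDeriv {n m : ℕ} (f : EuclideanSpace ℝ (Fin n) → ℝ)
    (hf : ContDiffOn ℝ (m : ℕ∞) f (ball 0 1)) (k : ℕ) (hk : k < m)
    (x v : EuclideanSpace ℝ (Fin n)) (t : ℝ) (ht : x + t • v ∈ ball (0 : EuclideanSpace ℝ (Fin n)) 1)
    (w : Fin k → EuclideanSpace ℝ (Fin n)) :
    HasDerivAt (fun t : ℝ => iteratedFDerivWithin ℝ k f (ball 0 1) (x + t • v) w)
      (iteratedFDerivWithin ℝ (k+1) f (ball 0 1) (x + t • v) (Fin.cons v w)) t := by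
  have hd := hf.differentiableOn_iteratedFDerivWithin (m := k) (by exact_mod_cast hk)
    isOpen_ball.uniqueDiffOn
  have h1 := ((hd _ ht).hasFDerivWithinAt).hasFDerivAt (isOpen_ball.mem_nhds ht)
  have hl : HasDerivAt (fun t : ℝ => x + t • v) v t := by
    simpa using ((hasDerivAt_id t).smul_const v).const_add x
  have h2 := h1.comp_hasDerivAt t hl
  have h3 := ((ContinuousMultilinearMap.apply ℝ (fun _ : Fin k => EuclideanSpace ℝ (Fin n)) ℝ w).hasFDerivAt).comp_hasDerivAt t h2
  rw [iteratedFDerivWithin_succ_apply_left]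
  simpa [Function.comp_def] using h3

lemma aux_step {n m : ℕ} (f : EuclideanSpace ℝ (Fin n) → ℝ)
    (hf : ContDiffOn ℝ (m : ℕ∞) f (ball 0 1)) (D : ℕ → ℝ)
    (hD : ∀ k ≤ m, ∀ σ : Fin k → Fin n, ∀ x ∈ ball (0 : EuclideanSpace ℝ (Fin n)) 1,
      |mixedPartial k σ f x| ≤ D k)
    (k : ℕ) (hk : k + 2 ≤ m) (h : ℝ) (h0 : 0 < h) (h1 : h ≤ 1)
    (σ : Fin (k+1) → Fin n) (x : EuclideanSpace ℝ (Fin n))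
    (hx : x ∈ ball (0 : EuclideanSpace ℝ (Fin n)) 1) :
    |mixedPartial (k+1) σ f x| ≤ 2 * (2 * D k / h + h * (2 * n * (2 * n * D (k+2)))) := by
  set w : Fin k → EuclideanSpace ℝ (Fin n) := fun i => EuclideanSpace.single (σ i.succ) 1 with hw
  have key : ∀ y ∈ ball (0 : EuclideanSpace ℝ (Fin n)) 1,
      |iteratedFDerivWithin ℝ (k+1) f (ball 0 1) x (Fin.cons (y - x) w)|
        ≤ 2 * D k / h + h * (2 * n * (2 * n * D (k+2))) := by
    intro y hy
    set v := y - x with hv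
    have hv2 : ‖v‖ ≤ 2 := by
      have := norm_sub_le y x
      rw [mem_ball_zero_iff] at hx hy
      linarith
    have hmem : ∀ t ∈ Set.Icc 0 h, x + t • v ∈ ball (0 : EuclideanSpace ℝ (Fin n)) 1 :=
      fun t ht => (convex_ball _ _).add_smul_sub_mem hx hy ⟨ht.1, ht.2.trans h1⟩
    have := aux_oneDim
      (fun t => iteratedFDerivWithin ℝ k f (ball 0 1) (x + t • v) w)
      (fun t => iteratedFDerivWithin ℝ (k+1) f (ball 0 1) (x + t • v) (Fin.cons v w))
      (fun t => iteratedFDerivWithin ℝ (k+1+1) f (ball 0 1) (x + t • v) (Fin.cons v (Fin.cons v w)))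
      h (D k) (2 * n * (2 * n * D (k+2))) h0
      (fun t ht => aux_hasDeriv f hf k (by omega) x v t (hmem t ht) w)
      (fun t ht => aux_hasDeriv f hf (k+1) (by omega) x v t (hmem t ht) _)
      (fun t ht => hD k (by omega) (fun i => σ i.succ) _ (hmem t ht))
      (by
        intro t ht
        set T := iteratedFDerivWithin ℝ (k+1+1) f (ball 0 1) (x + t • v) with hT
        have e1 : ∀ u : EuclideanSpace ℝ (Fin n), ∀ z : Fin (k+1) → EuclideanSpace ℝ (Fin n),
          ((ContinuousMultilinearMap.apply ℝ (fun _ : Fin (k+1) => EuclideanSpace ℝ (Fin n)) ℝ z).comp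
            T.curryLeft) u = T (Fin.cons u z) := fun u z => rfl
        have e2 : ∀ u u' : EuclideanSpace ℝ (Fin n),
          ((ContinuousMultilinearMap.apply ℝ (fun _ : Fin k => EuclideanSpace ℝ (Fin n)) ℝ w).comp
            (T.curryLeft u).curryLeft) u' = T (Fin.cons u (Fin.cons u' w)) := fun u z => rfl
        rw [← e1]
        apply aux_lin _ _ _ _ hv2
        intro i
        rw [e1, ← e2]
        apply aux_lin _ _ _ _ hv2
        intro j
        rw [e2]
        have := hD (k+2) hk (Fin.cons i (Fin.cons j (fun i => σ i.succ))) _ (hmem t ht)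
        convert this using 2
        unfold mixedPartial
        rw [hT]
        congr 1
        funext a
        refine Fin.cases ?_ (fun a => ?_) a
        · simp
        · refine Fin.cases ?_ (fun a => ?_) a <;> simp [hw])
    simpa using this
  have hy : ∀ c : ℝ, |c| = 1/2 → EuclideanSpace.single (σ 0) c ∈ ball (0 : EuclideanSpace ℝ (Fin n)) 1 := by
    intro c hc
    rw [mem_ball_zero_iff, EuclideanSpace.norm_single, Real.norm_eq_abs, hc]; norm_num
  have k1 := key _ (hy (1/2) (by norm_num))
  have k2 := key _ (hy (-(1/2)) (by norm_num [abs_neg]))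
  set T := iteratedFDerivWithin ℝ (k+1) f (ball 0 1) x with hT
  set L := (ContinuousMultilinearMap.apply ℝ (fun _ : Fin k => EuclideanSpace ℝ (Fin n)) ℝ w).comp
            T.curryLeft with hL
  have e1 : ∀ u : EuclideanSpace ℝ (Fin n), L u = T (Fin.cons u w) := fun u => rfl
  have e3 : mixedPartial (k+1) σ f x = L (EuclideanSpace.single (σ 0) 1) := by
    rw [e1]
    unfold mixedPartial
    rw [hT]
    congr 1
    funext a
    refine Fin.cases ?_ (fun a => ?_) a <;> simp [hw]
  have e4 : EuclideanSpace.single (σ 0) (1:ℝ) =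
      (EuclideanSpace.single (σ 0) (1/2:ℝ) - x) - (EuclideanSpace.single (σ 0) (-(1/2):ℝ) - x) := by
    ext i
    by_cases hi : i = σ 0 <;> simp [hi]
    norm_num
  rw [e3, e4, map_sub, e1, e1]
  refine (abs_sub _ _).trans ?_
  linarith

lemma aux_seq (K : ℝ) (hK : 1 ≤ K) (d : ℕ) : ∀ η : ℝ, 0 < η → ∃ C : ℝ, 0 ≤ C ∧
    ∀ (A : ℕ → ℝ) (l m : ℕ), (∀ k, 0 ≤ A k) →
      (∀ k, k + 2 ≤ m → ∀ δ : ℝ, 0 < δ → δ ≤ 1 → A (k+1) ≤ K / δ * A k + K * δ * A (k+2)) →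
      l + d < m → A (l + d) ≤ C * A l + η * A (l + d + 1) := by
  induction d with
  | zero =>
    intro η hη
    refine ⟨1, by norm_num, ?_⟩
    intro A l m hA _ _
    have := mul_nonneg hη.le (hA (l+0+1))
    simp at *; linarith
  | succ d ih =>
    intro η hη
    obtain ⟨δ, hδ0, hδ1, hδη⟩ : ∃ δ : ℝ, 0 < δ ∧ δ ≤ 1 ∧ 2 * K * δ ≤ η := by
      refine ⟨min 1 (η / (2 * K)), by positivity, min_le_left _ _, ?_⟩
      calc 2 * K * min 1 (η / (2 * K)) ≤ 2 * K * (η / (2 * K)) := by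
            gcongr; exact min_le_right _ _
        _ = η := by field_simp
    obtain ⟨C, hC, H⟩ := ih (δ / (2 * K)) (by positivity)
    refine ⟨2 * (K / δ * C), by positivity, ?_⟩
    intro A l m hA hstep hlm
    have a1 := H A l m hA hstep (by omega)
    have a2 := hstep (l + d) (by omega) δ hδ0 hδ1
    have a3 : K / δ * A (l+d) ≤ K / δ * C * A l + 1/2 * A (l+d+1) := by
      calc K / δ * A (l+d) ≤ K / δ * (C * A l + δ / (2 * K) * A (l + d + 1)) := by gcongr
        _ = _ := by field_simp
    have a4 : 2 * K * δ * A (l+d+2) ≤ η * A (l+d+2) := by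
      have := hA (l+d+2)
      gcongr
    show A (l + d + 1) ≤ _ * A l + η * A (l + d + 2)
    linarith

lemma aux_final (K : ℝ) (hK : 1 ≤ K) (m : ℕ) : ∃ C : ℝ, 0 < C ∧
    ∀ (A : ℕ → ℝ) (l : ℕ), (∀ k, 0 ≤ A k) → l < m → 
      (∀ k, k + 2 ≤ m → ∀ δ : ℝ, 0 < δ → δ ≤ 1 → A (k+1) ≤ K / δ * A k + K * δ * A (k+2)) →
      (∃ k, l ≤ k ∧ k < m ∧ A m ≤ A k) → ∀ a, l ≤ a → a ≤ m → A a ≤ C * A l := by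
  choose C hC H using fun d => aux_seq K hK d (1/2) (by norm_num)
  refine ⟨2 * ∑ d ∈ Finset.range m, C d + 1, by
    have := Finset.sum_nonneg (s := Finset.range m) (fun d _ => hC d)
    linarith, ?_⟩
  intro A l hA hl hstep ⟨k0, hk0, hk0m, hmax⟩ a hla ham
  obtain ⟨k, hk, hkmax⟩ := Finset.exists_max_image (Finset.Ico l m) A ⟨l, by simp [hl]⟩
  rw [Finset.mem_Ico] at hk
  have hm' : A m ≤ A k := hmax.trans (hkmax k0 (by simp [*]))
  have hall : ∀ j, l ≤ j → j ≤ m → A j ≤ A k := by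
    intro j h1 h2
    rcases h2.lt_or_eq with h | h
    · exact hkmax j (by simp [*])
    · rw [h]; exact hm'
  have h1 := H (k - l) A l m hA hstep (by omega)
  rw [show l + (k - l) = k by omega] at h1
  have h2 := hall (k+1) (by omega) (by omega)
  have h3 : C (k - l) ≤ ∑ d ∈ Finset.range m, C d :=
    Finset.single_le_sum (fun d _ => hC d) (by simp; omega)
  have h4 := mul_le_mul_of_nonneg_right h3 (hA l)
  have h5 := hall a hla ham
  have := hA l
  nlinarith

/-- if `f ∈ C^m(𝔹)` (`m ≥ 2`) satisfies
`sup_{|α| = m} ε^{|α|} |∂^α f| ≤ sup_{ℓ ≤ |α| < m} ε^{|α|} |∂^α f|`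
for some `0 < ε ≤ 1` and `0 ≤ ℓ < m`, then for every `ℓ ≤ |α| ≤ m`,
`sup |∂^α f| ≤ C ε^{-|α|} sup_{|β| = ℓ} ε^{|β|} |∂^β f|`, where `C` depends only
on the dimension `n` and on `m`. -/
theorem statement_0 (n m : ℕ) (hm : 2 ≤ m) :
    ∃ C : ℝ≥0∞, 0 < C ∧ C < ⊤ ∧
      ∀ f : EuclideanSpace ℝ (Fin n) → ℝ,
        ContDiffOn ℝ (m : ℕ∞) f (ball 0 1) →
        (∀ k ≤ m, derivSup n k f < ⊤) →
        ∀ ε : ℝ, 0 < ε → ε ≤ 1 → ∀ ℓ : ℕ, ℓ < m →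
          (ENNReal.ofReal ε ^ m * derivSup n m f ≤
            ⨆ k ∈ Set.Ico ℓ m, ENNReal.ofReal ε ^ k * derivSup n k f) →
          ∀ a : ℕ, ℓ ≤ a → a ≤ m →
            derivSup n a f ≤
              C * (ENNReal.ofReal ε)⁻¹ ^ a *
                (ENNReal.ofReal ε ^ ℓ * derivSup n ℓ f) := by
  have hn0 : (0:ℝ) ≤ n := Nat.cast_nonneg n
  obtain ⟨C, hC, H⟩ := aux_final (8 * n^2 + 4) (by nlinarith) m
  refine ⟨ENNReal.ofReal C, by simpa using hC, ENNReal.ofReal_lt_top, ?_⟩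
  intro f hf hfin ε hε hε1 l hl hyp a hla ham
  set D : ℕ → ℝ := fun k => (derivSup n k f).toReal with hDdef
  have hDD : ∀ k ≤ m, derivSup n k f = ENNReal.ofReal (D k) := fun k hk =>
    (ENNReal.ofReal_toReal (hfin k hk).ne).symm
  have hD0 : ∀ k, 0 ≤ D k := fun k => ENNReal.toReal_nonneg
  have hD : ∀ k ≤ m, ∀ σ : Fin k → Fin n, ∀ x ∈ ball (0 : EuclideanSpace ℝ (Fin n)) 1,
      |mixedPartial k σ f x| ≤ D k := by
    intro k hk σ x hx
    rw [← ENNReal.ofReal_le_ofReal_iff (hD0 k), ← hDD k hk]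
    unfold derivSup
    exact le_iSup₂_of_le x hx (le_iSup (fun σ => ENNReal.ofReal |mixedPartial k σ f x|) σ)
  have hstep : ∀ k, k + 2 ≤ m → ∀ h : ℝ, 0 < h → h ≤ 1 →
      D (k+1) ≤ 2 * (2 * D k / h + h * (2 * n * (2 * n * D (k+2)))) := by
    intro k hk h h0 h1
    have hpos : 0 ≤ 2 * (2 * D k / h + h * (2 * n * (2 * n * D (k+2)))) := by
      have := hD0 k
      have := hD0 (k+2)
      positivity
    rw [← ENNReal.ofReal_le_ofReal_iff hpos, ← hDD (k+1) (by omega)]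
    unfold derivSup
    refine iSup₂_le fun x hx => iSup_le fun σ => ENNReal.ofReal_le_ofReal ?_
    exact aux_step f hf D hD k hk h h0 h1 σ x hx
  have hA : ∀ k ≤ m, ENNReal.ofReal ε ^ k * derivSup n k f = ENNReal.ofReal (ε ^ k * D k) := by
    intro k hk
    rw [hDD k hk, ENNReal.ofReal_mul (by positivity), ENNReal.ofReal_pow hε.le]
  have fin := H (fun k => ε ^ k * D k) l (fun k => mul_nonneg (by positivity) (hD0 k)) hl ?_ ?_ a hla ham
  · rw [hA l hl.le, mul_right_comm, ← ENNReal.ofReal_mul hC.le, ← ENNReal.ofReal_inv_of_pos hε,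
      ← ENNReal.ofReal_pow (by positivity), hDD a ham, ← ENNReal.ofReal_mul
        (mul_nonneg hC.le (mul_nonneg (by positivity) (hD0 l)))]
    apply ENNReal.ofReal_le_ofReal
    rw [inv_pow, ← div_eq_mul_inv, le_div_iff₀ (by positivity), mul_comm]
    exact fin
  · intro k hk δ hδ hδ1
    have h1 := hstep k hk (ε * δ) (by positivity) (by nlinarith)
    have d0 := hD0 k
    have d2 := hD0 (k+2)
    have h2 : ε ^ (k+1) * D (k+1) ≤ ε ^ (k+1) * (2 * (2 * D k / (ε * δ) + (ε * δ) * (2 * n * (2 * n * D (k+2))))) := by gcongr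
    have h3 : ε ^ (k+1) * (2 * (2 * D k / (ε * δ) + (ε * δ) * (2 * n * (2 * n * D (k+2)))))
      = 4 / δ * (ε ^ k * D k) + (8 * n^2) * δ * (ε ^ (k+2) * D (k+2)) := by
      field_simp
      ring
    refine (h2.trans h3.le).trans ?_
    have : (0:ℝ) ≤ 8 * n^2 := by positivity
    gcongr <;> linarith
  · by_contra hcon
    push Not at hcon
    obtain ⟨k, hk, hkmax⟩ := Finset.exists_max_image (Finset.Ico l m) (fun k => ε ^ k * D k) ⟨l, by simp [hl]⟩
    rw [Finset.mem_Ico] at hk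
    have h1 : (⨆ k ∈ Set.Ico l m, ENNReal.ofReal ε ^ k * derivSup n k f) ≤ ENNReal.ofReal (ε ^ k * D k) := by
      refine iSup₂_le fun j hj => ?_
      rw [hA j hj.2.le]
      exact ENNReal.ofReal_le_ofReal (hkmax j (by simpa using hj))
    have h2 := hyp.trans h1
    rw [hA m le_rfl, ENNReal.ofReal_le_ofReal_iff (mul_nonneg (by positivity) (hD0 k))] at h2
    exact absurd h2 (not_le.2 (hcon k hk.1 hk.2))
end

section
/- Let m ≥ 2 and let f be a convex function on an open convex set Ω ⊂ R^d containing the origin, with f(0) = 0 and ∇f(0) = 0, and suppose f is uniformly radially tame to order m on Ω with constant C₀. Then for every compactly supported ψ ∈ C^m(Ω), every real λ, and every nonnegative integer ℓ, | ∫_Ω e^{iλf(x)} (f(x))^ℓ ψ(x) dx | ≤ C ∫_Ω |f(x)|^ℓ Σ_{k=0}^{m−1} |(x·∇)^k ψ(x)| / (1 + |λ f(x)|)^{m−1} dx, where C depends only on m, d, ℓ, and C₀. -/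
open Metric Set MeasureTheory
open scoped ENNReal

/-- The parameter interval of the ray from the origin in direction `v`
inside `Ω` (parametrized by arc length when `‖v‖ = 1`). -/
def raySet {d : ℕ} (Ω : Set (EuclideanSpace ℝ (Fin d)))
    (v : EuclideanSpace ℝ (Fin d)) : Set ℝ :=
  {t : ℝ | 0 ≤ t ∧ t • v ∈ Ω}

/-- `f` is uniformly radially tame to order `m` on `Ω` with constant `C`:
for every ray from the origin, the restriction `g(t) = f(tv)` (arc-length
parametrization, `‖v‖ = 1`) is `C^m` on the ray and satisfies
`|g(t)|^{k-1} |g^{(k)}(t)| ≤ C |g'(t)|^k` for all `2 ≤ k ≤ m`. -/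
def UniformlyRadiallyTame {d : ℕ} (Ω : Set (EuclideanSpace ℝ (Fin d)))
    (f : EuclideanSpace ℝ (Fin d) → ℝ) (m : ℕ) (C : ℝ) : Prop :=
  ∀ v : EuclideanSpace ℝ (Fin d), ‖v‖ = 1 →
    ContDiffOn ℝ (m : ℕ∞) (fun t : ℝ => f (t • v)) (raySet Ω v) ∧
    ∀ k : ℕ, 2 ≤ k → k ≤ m → ∀ t ∈ raySet Ω v,
      |f (t • v)| ^ (k - 1) *
          |iteratedDerivWithin k (fun s : ℝ => f (s • v)) (raySet Ω v) t| ≤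
        C * |derivWithin (fun s : ℝ => f (s • v)) (raySet Ω v) t| ^ k

/-- The `k`-fold application of the radial differential operator `x·∇` to `ψ`,
with `(x·∇)^0 ψ = ψ`. -/
noncomputable def radialPow {d : ℕ} :
    ℕ → (EuclideanSpace ℝ (Fin d) → ℝ) → EuclideanSpace ℝ (Fin d) → ℝ
  | 0, ψ => ψ
  | (k + 1), ψ => fun x => fderiv ℝ (radialPow k ψ) x x


section helpers
open Filter Topology

structure Sit (m : ℕ) (C₀ : ℝ) where
  g : ℕ → ℝ → ℝ
  φ : ℕ → ℝ → ℝ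
  a : ℝ
  b : ℝ
  lam : ℝ
  ha : 0 ≤ a
  hab : a < b
  gder : ∀ k < m, ∀ t ∈ Ioo a b, HasDerivAt (g k) (g (k + 1) t) t
  gcont : ∀ k ≤ m, ContinuousOn (g k) (Ioo a b)
  gpos : ∀ t ∈ Ioo a b, 0 < g 0 t
  gslope : ∀ t ∈ Ioo a b, g 0 t ≤ (t - a) * g 1 t
  gbdd : ∃ M, ∀ t ∈ Ioo a b, g 0 t ≤ M
  gtame : ∀ k, 2 ≤ k → k ≤ m → ∀ t ∈ Ioo a b, g 0 t ^ (k - 1) * |g k t| ≤ C₀ * g 1 t ^ k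
  φcont : ∀ i < m, Continuous (φ i)
  φder : ∀ i, i + 1 < m → ∀ t ∈ Ioo a b, HasDerivAt (φ i) (φ (i + 1) t / t) t
  φb : ∀ i < m, φ i b = 0

namespace Sit

variable {m : ℕ} {C₀ : ℝ}

lemma tpos (S : Sit m C₀) {t : ℝ} (ht : t ∈ Ioo S.a S.b) : 0 < t := S.ha.trans_lt ht.1

lemma g1pos (S : Sit m C₀) {t : ℝ} (ht : t ∈ Ioo S.a S.b) : 0 < S.g 1 t := by
  have h1 := S.gpos t ht
  have h2 := S.gslope t ht
  have h3 : 0 < t - S.a := sub_pos.2 ht.1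
  by_contra h
  push Not at h
  nlinarith [mul_nonneg h3.le (neg_nonneg.2 h)]

noncomputable def q (S : Sit m C₀) (t : ℝ) : ℝ := S.g 0 t / S.g 1 t

lemma qpos (S : Sit m C₀) {t : ℝ} (ht : t ∈ Ioo S.a S.b) : 0 < S.q t :=
  div_pos (S.gpos t ht) (S.g1pos ht)

lemma qle (S : Sit m C₀) {t : ℝ} (ht : t ∈ Ioo S.a S.b) : S.q t ≤ t - S.a := by
  rw [q, div_le_iff₀ (S.g1pos ht)]; exact S.gslope t ht

def HasY (S : Sit m C₀) (F : ℝ → ℂ) (F' : ℂ) (t : ℝ) : Prop :=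
  HasDerivAt F (F' / (S.q t : ℂ)) t

lemma HasY.mul {S : Sit m C₀} {F G : ℝ → ℂ} {F' G' : ℂ} {t : ℝ} (hF : S.HasY F F' t)
    (hG : S.HasY G G' t) : S.HasY (fun t => F t * G t) (F' * G t + F t * G') t := by
  unfold HasY at *
  refine (HasDerivAt.mul hF hG).congr_deriv ?_
  ring

lemma HasY.add {S : Sit m C₀} {F G : ℝ → ℂ} {F' G' : ℂ} {t : ℝ} (hF : S.HasY F F' t)
    (hG : S.HasY G G' t) : S.HasY (fun t => F t + G t) (F' + G') t := by
  unfold HasY at *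
  refine (HasDerivAt.add hF hG).congr_deriv ?_
  ring

lemma HasY.pow {S : Sit m C₀} {F : ℝ → ℂ} {c : ℂ} {t : ℝ} (n : ℕ)
    (hF : S.HasY F (c * F t) t) : S.HasY (fun t => F t ^ n) (n * c * F t ^ n) t := by
  unfold HasY at *
  refine (HasDerivAt.pow hF n).congr_deriv ?_
  cases n with
  | zero => simp
  | succ n => simp; ring

lemma HasY.of_eq {S : Sit m C₀} {F : ℝ → ℂ} {F' G' : ℂ} {t : ℝ} (hF : S.HasY F F' t)
    (h : F' = G') : S.HasY F G' t := h ▸ hF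

lemma hasY_const (S : Sit m C₀) (c : ℂ) (t : ℝ) : S.HasY (fun _ => c) 0 t := by
  unfold HasY; simpa using hasDerivAt_const t c

lemma hasY_real {S : Sit m C₀} {F : ℝ → ℝ} {F' : ℝ} {t : ℝ} (ht : t ∈ Ioo S.a S.b)
    (h : HasDerivAt F F' t) : S.HasY (fun t => (F t : ℂ)) ((S.q t * F' : ℝ) : ℂ) t := by
  unfold HasY
  refine h.ofReal_comp.congr_deriv ?_
  have := (S.qpos ht).ne'
  rw [← Complex.ofReal_div, mul_div_cancel_left₀ _ this]

/-- the normalized derivatives -/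
noncomputable def h (k : ℕ) (S : Sit m C₀) (t : ℝ) : ℂ :=
  ((S.g 0 t ^ (k - 1) * S.g k t / S.g 1 t ^ k : ℝ) : ℂ)

noncomputable def r (S : Sit m C₀) (t : ℝ) : ℂ := ((S.q t / t : ℝ) : ℂ)

noncomputable def P (S : Sit m C₀) (t : ℝ) : ℂ := 1 + Complex.I * ((S.lam * S.g 0 t : ℝ) : ℂ)

noncomputable def R (S : Sit m C₀) (t : ℝ) : ℂ := (S.P t)⁻¹

noncomputable def E (S : Sit m C₀) (t : ℝ) : ℂ := Complex.exp (Complex.I * ((S.lam * S.g 0 t : ℝ) : ℂ))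

lemma Pne (S : Sit m C₀) (t : ℝ) : S.P t ≠ 0 := by
  intro h
  have := congrArg Complex.re h
  simp [P] at this

lemma hasY_g0 (hm : 2 ≤ m) (S : Sit m C₀) {t : ℝ} (ht : t ∈ Ioo S.a S.b) :
    S.HasY (fun t => (S.g 0 t : ℂ)) (S.g 0 t) t := by
  refine (hasY_real ht (S.gder 0 (by omega) t ht)).of_eq ?_
  have := (S.g1pos ht).ne'
  norm_cast
  simp only [q]
  field_simp

lemma q_hasDerivAt (hm : 2 ≤ m) (S : Sit m C₀) {t : ℝ} (ht : t ∈ Ioo S.a S.b) :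
    HasDerivAt S.q (1 - S.g 0 t ^ (2 - 1) * S.g 2 t / S.g 1 t ^ 2) t := by
  have := (S.g1pos ht).ne'
  have h := (S.gder 0 (by omega) t ht).div (S.gder 1 (by omega) t ht) this
  refine h.congr_deriv ?_
  simp
  field_simp

lemma hasY_q (hm : 2 ≤ m) (S : Sit m C₀) {t : ℝ} (ht : t ∈ Ioo S.a S.b) :
    S.HasY (fun t => (S.q t : ℂ)) ((1 - h 2 S t) * S.q t) t := by
  refine (hasY_real ht (S.q_hasDerivAt hm ht)).of_eq ?_
  simp only [h]; push_cast; ring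

lemma hasY_t (S : Sit m C₀) {t : ℝ} (ht : t ∈ Ioo S.a S.b) :
    S.HasY (fun t => (t : ℂ)) (S.r t * t) t := by
  refine (hasY_real ht (hasDerivAt_id t)).of_eq ?_
  have := (S.tpos ht).ne'
  simp only [r]; norm_cast; field_simp

lemma hasY_r (hm : 2 ≤ m) (S : Sit m C₀) {t : ℝ} (ht : t ∈ Ioo S.a S.b) :
    S.HasY S.r (S.r t * ((1 - h 2 S t) + (-1) * S.r t)) t := by
  have h0 := (S.tpos ht).ne'
  refine (hasY_real ht ((S.q_hasDerivAt hm ht).div (hasDerivAt_id t) h0)).of_eq ?_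
  simp only [r, h]; norm_cast; push_cast; simp; field_simp; ring

lemma hasY_h (hm : 2 ≤ m) (S : Sit m C₀) {k : ℕ} (hk : 2 ≤ k) (hkm : k < m) {t : ℝ}
    (ht : t ∈ Ioo S.a S.b) :
    S.HasY (h k S) (((k - 1 : ℕ) : ℂ) * h k S t + (h (k + 1) S t + (-k) * (h k S t * h 2 S t))) t := by
  have h0 := (S.g1pos ht).ne'
  have h00 := (S.gpos t ht).ne'
  obtain ⟨k, rfl⟩ : ∃ j, k = j + 2 := ⟨k - 2, by omega⟩
  refine (hasY_real ht ((((S.gder 0 (by omega) t ht).pow (k + 2 - 1)).mul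
    (S.gder (k + 2) hkm t ht)).div ((S.gder 1 (by omega) t ht).pow (k + 2)) (pow_ne_zero _ h0))).of_eq ?_
  simp only [h, q]; norm_cast; push_cast; simp; field_simp; ring

lemma hasY_R (hm : 2 ≤ m) (S : Sit m C₀) {t : ℝ} (ht : t ∈ Ioo S.a S.b) :
    S.HasY S.R ((R S t + (-1)) * R S t) t := by
  have h1 := S.hasY_g0 hm ht
  have hP := S.Pne t
  have hq := (S.qpos ht).ne'
  unfold HasY at *
  have h2 : HasDerivAt S.P (Complex.I * (S.lam * ((S.g 0 t : ℂ) / (S.q t : ℂ)))) t := by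
    have := (((h1.const_mul (S.lam : ℂ)).const_mul Complex.I).const_add 1)
    refine this.congr_of_eventuallyEq (Eventually.of_forall fun x => ?_)
    simp [P]
  refine (h2.inv hP).congr_deriv ?_
  have : Complex.I * (S.lam * ((S.g 0 t : ℂ) / (S.q t : ℂ))) = (S.P t - 1) / S.q t := by
    simp [P]; ring
  rw [this]
  simp only [R]
  field_simp
  ring

lemma hasY_E (hm : 2 ≤ m) (S : Sit m C₀) {t : ℝ} (ht : t ∈ Ioo S.a S.b) :
    S.HasY S.E ((S.P t - 1) * S.E t) t := by
  have h1 := S.hasY_g0 hm ht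
  unfold HasY at *
  have := (((h1.const_mul (S.lam : ℂ)).const_mul Complex.I)).cexp
  refine (this.congr_of_eventuallyEq (Eventually.of_forall fun x => ?_)).congr_deriv ?_
  · simp [E]
  · simp [E, P]; ring

lemma hasY_φ (S : Sit m C₀) {i : ℕ} (hi : i + 1 < m) {t : ℝ} (ht : t ∈ Ioo S.a S.b) :
    S.HasY (fun t => (S.φ i t : ℂ)) (S.r t * S.φ (i + 1) t) t := by
  refine (hasY_real ht (S.φder i hi t ht)).of_eq ?_
  simp only [r]; norm_cast; ring

def B (c : Sit m C₀ → ℝ → ℂ) : Prop :=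
  (∃ K, ∀ S, ∀ t ∈ Ioo S.a S.b, ‖c S t‖ ≤ K) ∧ ∀ S, ContinuousOn (c S) (Ioo S.a S.b)

def UB {m : ℕ} {C₀ : ℝ} : ℕ → (Sit m C₀ → ℝ → ℂ) → Prop
  | 0, c => B c
  | k + 1, c => B c ∧ ∃ c' : Sit m C₀ → ℝ → ℂ, UB k c' ∧ ∀ S : Sit m C₀, ∀ t ∈ Ioo S.a S.b, S.HasY (c S) (c' S t) t

lemma UB.B {k : ℕ} {c : Sit m C₀ → ℝ → ℂ} (h : UB k c) : B c := by
  cases k with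
  | zero => exact h
  | succ k => exact h.1

lemma UB.pred {k : ℕ} {c : Sit m C₀ → ℝ → ℂ} (h : UB (k + 1) c) : UB k c := by
  induction k generalizing c with
  | zero => exact h.1
  | succ k ih =>
    obtain ⟨h1, c', h2, h3⟩ := h
    exact ⟨h1, c', ih h2, h3⟩

lemma B.add {c d : Sit m C₀ → ℝ → ℂ} (hc : B c) (hd : B d) : B (fun S t => c S t + d S t) := by
  obtain ⟨⟨K, hK⟩, h⟩ := hc
  obtain ⟨⟨K', hK'⟩, h'⟩ := hd
  exact ⟨⟨K + K', fun S t ht => (norm_add_le _ _).trans (add_le_add (hK S t ht) (hK' S t ht))⟩,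
    fun S => (h S).add (h' S)⟩

lemma B.mul {c d : Sit m C₀ → ℝ → ℂ} (hc : B c) (hd : B d) : B (fun S t => c S t * d S t) := by
  obtain ⟨⟨K, hK⟩, h⟩ := hc
  obtain ⟨⟨K', hK'⟩, h'⟩ := hd
  refine ⟨⟨K * K', fun S t ht => ?_⟩, fun S => (h S).mul (h' S)⟩
  rw [norm_mul]
  exact mul_le_mul (hK S t ht) (hK' S t ht) (norm_nonneg _) ((norm_nonneg _).trans (hK S t ht))

lemma UB.add {k : ℕ} {c d : Sit m C₀ → ℝ → ℂ} (hc : UB k c) (hd : UB k d) :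
    UB k (fun S t => c S t + d S t) := by
  induction k generalizing c d with
  | zero => exact Sit.B.add hc hd
  | succ k ih =>
    obtain ⟨h1, c', h2, h3⟩ := hc
    obtain ⟨e1, d', e2, e3⟩ := hd
    exact ⟨h1.add e1, _, ih h2 e2, fun S t ht => (h3 S t ht).add (e3 S t ht)⟩

lemma UB.mul {k : ℕ} {c d : Sit m C₀ → ℝ → ℂ} (hc : UB k c) (hd : UB k d) :
    UB k (fun S t => c S t * d S t) := by
  induction k generalizing c d with
  | zero => exact Sit.B.mul hc hd
  | succ k ih =>
    have hc0 := hc.pred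
    have hd0 := hd.pred
    obtain ⟨h1, c', h2, h3⟩ := hc
    obtain ⟨e1, d', e2, e3⟩ := hd
    exact ⟨h1.mul e1, _, (ih h2 hd0).add (ih hc0 e2), fun S t ht => (h3 S t ht).mul (e3 S t ht)⟩

lemma UB_const (k : ℕ) (z : ℂ) : UB k (fun (_ : Sit m C₀) _ => z) := by
  have : ∀ z : ℂ, B (fun (_ : Sit m C₀) _ => z) := fun z =>
    ⟨⟨‖z‖, fun _ _ _ => le_rfl⟩, fun _ => continuousOn_const⟩
  induction k generalizing z with
  | zero => exact this z
  | succ k ih => exact ⟨this z, _, ih 0, fun S t _ => S.hasY_const z t⟩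

lemma UB_h (hm : 2 ≤ m) (j k : ℕ) (hk : 2 ≤ k) (hjk : k + j ≤ m) : UB j (h k : Sit m C₀ → ℝ → ℂ) := by
  have hB : ∀ k, 2 ≤ k → k ≤ m → B (h k : Sit m C₀ → ℝ → ℂ) := by
    intro k hk hkm
    refine ⟨⟨C₀, fun S t ht => ?_⟩, fun S => ?_⟩
    · have h1 := S.g1pos ht
      have h0 := S.gpos t ht
      simp only [h]
      rw [Complex.norm_real, Real.norm_eq_abs, abs_div, abs_mul, abs_of_pos (pow_pos h0 _),
        abs_of_pos (pow_pos h1 _), div_le_iff₀ (pow_pos h1 _)]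
      exact S.gtame k hk hkm t ht
    · refine Complex.continuous_ofReal.comp_continuousOn ?_
      exact (((S.gcont 0 (by omega)).pow _).mul (S.gcont k hkm)).div ((S.gcont 1 (by omega)).pow _)
        (fun t ht => pow_ne_zero _ (S.g1pos ht).ne')
  induction j generalizing k with
  | zero => exact hB k hk (by omega)
  | succ j ih =>
    refine ⟨hB k hk (by omega), _, ?_, fun S t ht => S.hasY_h hm hk (by omega) ht⟩
    exact ((UB_const _ _).mul (ih k hk (by omega))).add ((ih (k + 1) (by omega) (by omega)).add
      ((UB_const _ _).mul ((ih k hk (by omega)).mul (ih 2 le_rfl (by omega)))))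

lemma UB_r (hm : 2 ≤ m) (j : ℕ) (hj : j < m) : UB j (r : Sit m C₀ → ℝ → ℂ) := by
  have hB : B (r : Sit m C₀ → ℝ → ℂ) := by
    refine ⟨⟨1, fun S t ht => ?_⟩, fun S => ?_⟩
    · have h1 := S.qpos ht
      have h0 := S.tpos ht
      have h2 := S.qle ht
      have := S.ha
      simp only [r]
      rw [Complex.norm_real, Real.norm_eq_abs, abs_of_pos (by positivity), div_le_one h0]
      linarith
    · refine Complex.continuous_ofReal.comp_continuousOn ?_
      exact ((S.gcont 0 (by omega)).div (S.gcont 1 (by omega))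
        (fun t ht => (S.g1pos ht).ne')).div continuousOn_id (fun t ht => (S.tpos ht).ne')
  induction j with
  | zero => exact hB
  | succ j ih =>
    refine ⟨hB, _, ?_, fun S t ht => S.hasY_r hm ht⟩
    refine (ih (by omega)).mul (UB.add ?_ ((UB_const _ _).mul (ih (by omega))))
    have := (UB_const j 1).add ((UB_const j (-1)).mul (UB_h (C₀ := C₀) hm j 2 le_rfl (by omega)))
    simpa [sub_eq_add_neg] using this

lemma norm_P (S : Sit m C₀) (t : ℝ) : 1 ≤ ‖S.P t‖ ∧ |S.lam * S.g 0 t| ≤ ‖S.P t‖ := by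
  have h1 := Complex.abs_re_le_norm (S.P t)
  have h2 := Complex.abs_im_le_norm (S.P t)
  simp [P] at h1 h2 ⊢
  exact ⟨h1, h2⟩

lemma norm_R_le (S : Sit m C₀) (t : ℝ) : ‖S.R t‖ ≤ 1 := by
  rw [R, norm_inv]; exact inv_le_one_of_one_le₀ (S.norm_P t).1

lemma norm_R_le' (S : Sit m C₀) (t : ℝ) : ‖S.R t‖ ≤ 2 / (1 + |S.lam * S.g 0 t|) := by
  have h := S.norm_P t
  have : 0 ≤ |S.lam * S.g 0 t| := abs_nonneg _
  rw [R, norm_inv, inv_eq_one_div, div_le_div_iff₀ (by linarith) (by linarith)]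
  linarith

lemma cont_P (S : Sit m C₀) : ContinuousOn S.P (Ioo S.a S.b) := by
  have := S.gcont 0 (by omega)
  unfold P
  refine continuousOn_const.add (continuousOn_const.mul ?_)
  exact Complex.continuous_ofReal.comp_continuousOn (continuousOn_const.mul this)

lemma cont_R (S : Sit m C₀) : ContinuousOn S.R (Ioo S.a S.b) :=
  S.cont_P.inv₀ (fun t _ => S.Pne t)

lemma cont_E (S : Sit m C₀) : ContinuousOn S.E (Ioo S.a S.b) := by
  have := S.gcont 0 (by omega)
  unfold E
  refine Complex.continuous_exp.comp_continuousOn (continuousOn_const.mul ?_)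
  exact Complex.continuous_ofReal.comp_continuousOn (continuousOn_const.mul this)

lemma norm_E (S : Sit m C₀) (t : ℝ) : ‖S.E t‖ = 1 := by
  rw [E, mul_comm, Complex.norm_exp_ofReal_mul_I]

lemma UB_R (hm : 2 ≤ m) (j : ℕ) : UB j (R : Sit m C₀ → ℝ → ℂ) := by
  have hB : B (R : Sit m C₀ → ℝ → ℂ) := ⟨⟨1, fun S t _ => S.norm_R_le t⟩, fun S => S.cont_R⟩
  induction j with
  | zero => exact hB
  | succ j ih =>
    exact ⟨hB, _, (ih.add (UB_const _ _)).mul ih, fun S t ht => S.hasY_R hm ht⟩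

end Sit

namespace Sit

variable {m : ℕ} {C₀ : ℝ}

def LB {𝕜 : Type} [NormedField 𝕜] (S : Sit m C₀) (F : ℝ → 𝕜) : Prop :=
  ContinuousOn F (Ioo S.a S.b) ∧ ∃ M, ∀ t ∈ Ioo S.a S.b, ‖F t‖ ≤ M

lemma LB.mul {𝕜 : Type} [NormedField 𝕜] {S : Sit m C₀} {F G : ℝ → 𝕜} (hF : S.LB F) (hG : S.LB G) :
    S.LB (fun t => F t * G t) := by
  obtain ⟨h, K, hK⟩ := hF
  obtain ⟨h', K', hK'⟩ := hG
  refine ⟨h.mul h', K * K', fun t ht => ?_⟩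
  rw [norm_mul]
  exact mul_le_mul (hK t ht) (hK' t ht) (norm_nonneg _) ((norm_nonneg _).trans (hK t ht))

lemma LB.add {𝕜 : Type} [NormedField 𝕜] {S : Sit m C₀} {F G : ℝ → 𝕜} (hF : S.LB F) (hG : S.LB G) :
    S.LB (fun t => F t + G t) := by
  obtain ⟨h, K, hK⟩ := hF
  obtain ⟨h', K', hK'⟩ := hG
  exact ⟨h.add h', K + K', fun t ht => (norm_add_le _ _).trans (add_le_add (hK t ht) (hK' t ht))⟩

lemma LB.pow {𝕜 : Type} [NormedField 𝕜] {S : Sit m C₀} {F : ℝ → 𝕜} (hF : S.LB F) (n : ℕ) :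
    S.LB (fun t => F t ^ n) := by
  obtain ⟨h, K, hK⟩ := hF
  refine ⟨h.pow n, K ^ n, fun t ht => ?_⟩
  rw [norm_pow]
  exact pow_le_pow_left₀ (norm_nonneg _) (hK t ht) n

lemma LB.ofReal {S : Sit m C₀} {F : ℝ → ℝ} (hF : S.LB F) : S.LB (fun t => (F t : ℂ)) := by
  obtain ⟨h, K, hK⟩ := hF
  refine ⟨Complex.continuous_ofReal.comp_continuousOn h, K, fun t ht => ?_⟩
  rw [Complex.norm_real]; exact hK t ht

lemma LB.norm {S : Sit m C₀} {F : ℝ → ℂ} (hF : S.LB F) : S.LB (fun t => ‖F t‖) := by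
  obtain ⟨h, K, hK⟩ := hF
  refine ⟨h.norm, K, fun t ht => ?_⟩
  rw [norm_norm]; exact hK t ht

lemma LB.intervalIntegrable {𝕜 : Type} [NormedField 𝕜] {S : Sit m C₀} {F : ℝ → 𝕜} (hF : S.LB F) :
    IntervalIntegrable F volume S.a S.b := by
  obtain ⟨h, K, hK⟩ := hF
  rw [intervalIntegrable_iff_integrableOn_Ioo_of_le S.hab.le]
  refine IntegrableOn.of_bound (C := K) (by simp)
    (h.aestronglyMeasurable measurableSet_Ioo) ?_
  exact (ae_restrict_iff' measurableSet_Ioo).2 (Eventually.of_forall hK)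

lemma LB_of_cont {𝕜 : Type} [NormedField 𝕜] (S : Sit m C₀) {F : ℝ → 𝕜} (hF : Continuous F) :
    S.LB F := by
  obtain ⟨K, hK⟩ := isCompact_Icc.exists_bound_of_continuousOn (s := Icc S.a S.b) hF.continuousOn
  exact ⟨hF.continuousOn, K, fun t ht => hK t ⟨ht.1.le, ht.2.le⟩⟩

lemma LB_g (S : Sit m C₀) : S.LB (S.g 0) := by
  obtain ⟨M, hM⟩ := S.gbdd
  refine ⟨S.gcont 0 (by omega), M, fun t ht => ?_⟩
  rw [Real.norm_eq_abs, abs_of_pos (S.gpos t ht)]; exact hM t ht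

lemma LB_E (S : Sit m C₀) : S.LB S.E := ⟨S.cont_E, 1, fun t _ => (S.norm_E t).le⟩
lemma LB_R (S : Sit m C₀) : S.LB S.R := ⟨S.cont_R, 1, fun t _ => S.norm_R_le t⟩

lemma LB_B {c : Sit m C₀ → ℝ → ℂ} (h : B c) (S : Sit m C₀) : S.LB (c S) := by
  obtain ⟨⟨K, hK⟩, h⟩ := h
  exact ⟨h S, K, hK S⟩

/-- integrand -/
noncomputable def X (e ℓ : ℕ) (S : Sit m C₀) (n i : ℕ) (c : Sit m C₀ → ℝ → ℂ) (t : ℝ) : ℂ :=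
  S.E t * (S.R t ^ n * ((t : ℂ) ^ e * ((S.g 0 t : ℂ) ^ ℓ * (c S t * (S.φ i t : ℂ)))))

/-- bound integrand -/
noncomputable def J (e ℓ : ℕ) (S : Sit m C₀) (n : ℕ) (t : ℝ) : ℝ :=
  ‖S.R t‖ ^ n * (t ^ e * (S.g 0 t ^ ℓ * ∑ j ∈ Finset.range m, |S.φ j t|))

lemma LB_X (e ℓ : ℕ) (S : Sit m C₀) (n i : ℕ) (hi : i < m) {c : Sit m C₀ → ℝ → ℂ} (hc : B c) :
    S.LB (X e ℓ S n i c) :=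
  S.LB_E.mul ((S.LB_R.pow n).mul (((S.LB_of_cont Complex.continuous_ofReal).pow e).mul
    ((S.LB_g.ofReal.pow ℓ).mul ((LB_B hc S).mul
      (S.LB_of_cont (Complex.continuous_ofReal.comp (S.φcont i hi)))))))

lemma LB_J (e ℓ : ℕ) (S : Sit m C₀) (n : ℕ) : S.LB (J e ℓ S n) := by
  refine (S.LB_R.norm.pow n).mul (((S.LB_of_cont continuous_id).pow e).mul
    ((S.LB_g.pow ℓ).mul (S.LB_of_cont ?_)))
  exact continuous_finsetSum _ fun j hj => (S.φcont j (Finset.mem_range.1 hj)).abs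

lemma integral_le (S : Sit m C₀) {F : ℝ → ℂ} {G : ℝ → ℝ} (hG : S.LB G)
    (h : ∀ t ∈ Ioo S.a S.b, ‖F t‖ ≤ G t) :
    ‖∫ t in S.a..S.b, F t‖ ≤ ∫ t in S.a..S.b, G t := by
  refine intervalIntegral.norm_integral_le_of_norm_le S.hab.le ?_ hG.intervalIntegrable
  have : ∀ᵐ t : ℝ, t ≠ S.b := by
    rw [ae_iff]; simp
  filter_upwards [this] with t ht ht'
  exact h t ⟨ht'.1, lt_of_le_of_ne ht'.2 ht⟩

lemma norm_X_le (e ℓ : ℕ) (S : Sit m C₀) (n i : ℕ) (hi : i < m) {c : Sit m C₀ → ℝ → ℂ} {K : ℝ}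
    {t : ℝ} (ht : t ∈ Ioo S.a S.b) (hK : ‖c S t‖ ≤ K) : ‖X e ℓ S n i c t‖ ≤ K * J e ℓ S n t := by
  have h0 := S.tpos ht
  have h1 := S.gpos t ht
  have h2 : |S.φ i t| ≤ ∑ j ∈ Finset.range m, |S.φ j t| :=
    Finset.single_le_sum (f := fun j => |S.φ j t|) (fun _ _ => abs_nonneg _) (Finset.mem_range.2 hi)
  simp only [X, J, norm_mul, norm_pow, S.norm_E, Complex.norm_real, Real.norm_eq_abs, abs_of_pos h0,
    abs_of_pos h1, one_mul]
  have h3 : ‖c S t‖ * |S.φ i t| ≤ K * ∑ j ∈ Finset.range m, |S.φ j t| :=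
    mul_le_mul hK h2 (abs_nonneg _) ((norm_nonneg _).trans hK)
  calc _ ≤ ‖S.R t‖ ^ n * (t ^ e * (S.g 0 t ^ ℓ * (K * ∑ j ∈ Finset.range m, |S.φ j t|))) := by
        gcongr
    _ = _ := by ring

lemma hasDerivAt_w (hm : 2 ≤ m) (e ℓ : ℕ) (S : Sit m C₀) (n i : ℕ) (hi : i + 1 < m)
    {c c' : Sit m C₀ → ℝ → ℂ}
    {t : ℝ} (ht : t ∈ Ioo S.a S.b) (hc : S.HasY (c S) (c' S t) t) :
    HasDerivAt (fun t => (S.q t : ℂ) * X e ℓ S (n + 1) i c t)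
      (X e ℓ S n i c t + (X e ℓ S (n + 1) i (fun S t => ((((n + 1 : ℕ) : ℂ) * (R S t + (-1)) +
        ((-1) * h 2 S t + ((e : ℂ) * r S t + (ℓ : ℂ)))) * c S t + c' S t)) t +
        X e ℓ S (n + 1) (i + 1) (fun S t => r S t * c S t) t)) t := by
  have hq : (S.q t : ℂ) ≠ 0 := by exact_mod_cast (S.qpos ht).ne'
  have hRP : S.R t * S.P t = 1 := inv_mul_cancel₀ (S.Pne t)
  have hg : S.HasY (fun t => (S.g 0 t : ℂ)) (1 * (S.g 0 t : ℂ)) t := by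
    simpa using S.hasY_g0 hm ht
  have key := (S.hasY_q hm ht).mul ((S.hasY_E hm ht).mul (((S.hasY_R hm ht).pow (n + 1)).mul
    (((S.hasY_t ht).pow e).mul ((hg.pow ℓ).mul (hc.mul (S.hasY_φ hi ht))))))
  refine HasDerivAt.congr_deriv key ?_
  rw [div_eq_iff hq]
  simp only [X]
  linear_combination (S.q t : ℂ) * (S.E t * (S.R t ^ n * ((t : ℂ) ^ e * ((S.g 0 t : ℂ) ^ ℓ * (c S t * (S.φ i t : ℂ)))))) * hRP

lemma main_step (hm : 2 ≤ m) (e ℓ N n i : ℕ) {c : Sit m C₀ → ℝ → ℂ} (hc : UB N c)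
    (hi : i + N < m) : ∃ K, ∀ S : Sit m C₀,
      ‖∫ t in S.a..S.b, X e ℓ S n i c t‖ ≤ K * ∫ t in S.a..S.b, J e ℓ S (n + N) t := by
  induction N generalizing n i c with
  | zero =>
    obtain ⟨K, hK⟩ := hc.B.1
    refine ⟨K, fun S => ?_⟩
    rw [← intervalIntegral.integral_const_mul]
    exact S.integral_le ((S.LB_of_cont continuous_const).mul (S.LB_J e ℓ _))
      (fun t ht => norm_X_le e ℓ S n i (by omega) ht (hK S t ht))
  | succ N ih =>
    have hc0 := hc.pred
    obtain ⟨hB, c', hc', hY⟩ := hc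
    have hc1 : UB N (fun S t => ((((n + 1 : ℕ) : ℂ) * (R S t + (-1)) +
        ((-1) * h 2 S t + ((e : ℂ) * r S t + (ℓ : ℂ)))) * c S t + c' S t)) :=
      UB.add (UB.mul (((UB_const _ _).mul ((UB_R hm N).add (UB_const _ _))).add
        (((UB_const _ _).mul (UB_h hm N 2 le_rfl (by omega))).add
        (((UB_const _ _).mul (UB_r hm N (by omega))).add (UB_const _ _)))) hc0) hc'
    have hc2 : UB N (fun S t => r S t * c S t) := (UB_r hm N (by omega)).mul hc0
    obtain ⟨K1, h1⟩ := ih (n + 1) i hc1 (by omega)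
    obtain ⟨K2, h2⟩ := ih (n + 1) (i + 1) hc2 (by omega)
    refine ⟨K1 + K2, fun S => ?_⟩
    have L0 := LB_X e ℓ S n i (by omega) hB
    have L1 := LB_X e ℓ S (n + 1) i (by omega) hc1.B
    have L2 := LB_X e ℓ S (n + 1) (i + 1) (by omega) hc2.B
    have L3 := LB_X e ℓ S (n + 1) i (by omega) hB
    have hI := intervalIntegral.integral_eq_sub_of_hasDerivAt_of_tendsto S.hab
      (fun t ht => hasDerivAt_w hm e ℓ S n i (by omega) ht (hY S t ht))
      (L0.add (L1.add L2)).intervalIntegrable (fa := 0) (fb := 0) ?_ ?_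
    · rw [intervalIntegral.integral_add L0.intervalIntegrable (L1.add L2).intervalIntegrable,
        intervalIntegral.integral_add L1.intervalIntegrable L2.intervalIntegrable, sub_zero] at hI
      rw [eq_neg_of_add_eq_zero_left hI, norm_neg, add_mul]
      refine (norm_add_le _ _).trans ?_
      have e1 := h1 S
      have e2 := h2 S
      rw [show n + 1 + N = n + (N + 1) by omega] at e1 e2
      exact add_le_add e1 e2
    · obtain ⟨M, hM⟩ := L3.2
      have hI := Ioo_mem_nhdsGT S.hab
      refine squeeze_zero_norm' (a := fun t => (t - S.a) * M) ?_ ?_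
      · filter_upwards [hI] with t ht
        rw [norm_mul, Complex.norm_real, Real.norm_eq_abs, abs_of_pos (S.qpos ht)]
        exact mul_le_mul (S.qle ht) (hM t ht) (norm_nonneg _) (sub_nonneg.2 ht.1.le)
      · have : Tendsto (fun t => (t - S.a) * M) (𝓝 S.a) (𝓝 ((S.a - S.a) * M)) :=
          Continuous.tendsto (by fun_prop) _
        rw [sub_self, zero_mul] at this
        exact this.mono_left nhdsWithin_le_nhds
    · have L4 : S.LB (fun t => S.E t * (S.R t ^ (n + 1) * ((t : ℂ) ^ e * ((S.g 0 t : ℂ) ^ ℓ * c S t)))) :=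
        S.LB_E.mul ((S.LB_R.pow (n + 1)).mul (((S.LB_of_cont Complex.continuous_ofReal).pow e).mul
          ((S.LB_g.ofReal.pow ℓ).mul (LB_B hB S))))
      obtain ⟨M, hM⟩ := L4.2
      have hI := Ioo_mem_nhdsLT S.hab
      refine squeeze_zero_norm' (a := fun t => (t - S.a) * (M * |S.φ i t|)) ?_ ?_
      · filter_upwards [hI] with t ht
        have : X e ℓ S (n + 1) i c t = (S.E t * (S.R t ^ (n + 1) * ((t : ℂ) ^ e * ((S.g 0 t : ℂ) ^ ℓ * c S t)))) * (S.φ i t : ℂ) := by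
          simp only [X]; ring
        rw [this, norm_mul, norm_mul, Complex.norm_real, Real.norm_eq_abs, abs_of_pos (S.qpos ht),
          Complex.norm_real, Real.norm_eq_abs]
        exact mul_le_mul (S.qle ht) (mul_le_mul_of_nonneg_right (hM t ht) (abs_nonneg _))
          (by positivity) (sub_nonneg.2 ht.1.le)
      · have hφ := S.φcont i (by omega)
        have : Tendsto (fun t => (t - S.a) * (M * |S.φ i t|)) (𝓝 S.b) (𝓝 ((S.b - S.a) * (M * |S.φ i S.b|))) :=
          Continuous.tendsto (by fun_prop) _
        rw [S.φb i (by omega), abs_zero, mul_zero, mul_zero] at this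
        exact this.mono_left nhdsWithin_le_nhds

lemma oneD (hm : 2 ≤ m) (C₀ : ℝ) (e ℓ : ℕ) : ∃ K, 0 ≤ K ∧ ∀ S : Sit m C₀,
    ‖∫ t in S.a..S.b, S.E t * ((t ^ e * (S.g 0 t ^ ℓ * S.φ 0 t) : ℝ) : ℂ)‖ ≤
      K * ∫ t in S.a..S.b, t ^ e * (S.g 0 t ^ ℓ * ∑ j ∈ Finset.range m, |S.φ j t|) /
        (1 + |S.lam * S.g 0 t|) ^ (m - 1) := by
  obtain ⟨K, hK⟩ := main_step (C₀ := C₀) hm e ℓ (m - 1) 0 0 (UB_const _ 1) (by omega)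
  refine ⟨|K| * 2 ^ (m - 1), by positivity, fun S => ?_⟩
  have hX : (fun t => S.E t * ((t ^ e * (S.g 0 t ^ ℓ * S.φ 0 t) : ℝ) : ℂ)) =
      X e ℓ S 0 0 (fun _ _ => 1) := by
    ext t; simp [X]
  have hpos : ∀ t, 0 < 1 + |S.lam * S.g 0 t| := fun t => by positivity
  have hG : S.LB (fun t => t ^ e * (S.g 0 t ^ ℓ * ∑ j ∈ Finset.range m, |S.φ j t|) /
        (1 + |S.lam * S.g 0 t|) ^ (m - 1)) := by
    simp only [div_eq_mul_inv]
    refine (((S.LB_of_cont continuous_id).pow e).mul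
      ((S.LB_g.pow ℓ).mul (S.LB_of_cont ?_))).mul ⟨?_, 1, fun t _ => ?_⟩
    · exact continuous_finsetSum _ fun j hj => (S.φcont j (Finset.mem_range.1 hj)).abs
    · exact ContinuousOn.inv₀ ((continuousOn_const.add
        (continuousOn_const.mul (S.gcont 0 (by omega))).abs).pow _)
        (fun t _ => pow_ne_zero _ (hpos t).ne')
    · rw [norm_inv, norm_pow, Real.norm_eq_abs, abs_of_pos (hpos t)]
      exact inv_le_one_of_one_le₀ (one_le_pow₀ (by linarith [abs_nonneg (S.lam * S.g 0 t)]))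
  have h2 : ∀ t ∈ Ioo S.a S.b, J e ℓ S (0 + (m - 1)) t ≤ 2 ^ (m - 1) *
      (t ^ e * (S.g 0 t ^ ℓ * ∑ j ∈ Finset.range m, |S.φ j t|) /
        (1 + |S.lam * S.g 0 t|) ^ (m - 1)) := by
    intro t ht
    have h0 := S.tpos ht
    have h1 := S.gpos t ht
    have h3 : 0 ≤ ∑ j ∈ Finset.range m, |S.φ j t| := Finset.sum_nonneg fun _ _ => abs_nonneg _
    have h4 : ‖S.R t‖ ^ (m - 1) ≤ (2 / (1 + |S.lam * S.g 0 t|)) ^ (m - 1) :=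
      pow_le_pow_left₀ (norm_nonneg _) (S.norm_R_le' t) _
    rw [zero_add]
    simp only [J]
    calc _ ≤ (2 / (1 + |S.lam * S.g 0 t|)) ^ (m - 1) *
          (t ^ e * (S.g 0 t ^ ℓ * ∑ j ∈ Finset.range m, |S.φ j t|)) := by gcongr
      _ = _ := by rw [div_pow]; ring
  have h3 := intervalIntegral.integral_mono_on_of_le_Ioo S.hab.le
    (S.LB_J e ℓ (0 + (m - 1))).intervalIntegrable
    ((S.LB_of_cont continuous_const).mul hG).intervalIntegrable h2
  rw [intervalIntegral.integral_const_mul] at h3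
  have h4 : 0 ≤ ∫ t in S.a..S.b, J e ℓ S (0 + (m - 1)) t := by
    have := S.integral_le (F := fun _ => 0) (S.LB_J e ℓ (0 + (m - 1))) (fun t ht => by
      have h0 := S.tpos ht
      have h1 := S.gpos t ht
      have h3 : 0 ≤ ∑ j ∈ Finset.range m, |S.φ j t| := Finset.sum_nonneg fun _ _ => abs_nonneg _
      rw [norm_zero]; unfold J; positivity)
    exact (norm_nonneg _).trans this
  rw [hX, mul_assoc]
  refine (hK S).trans ((mul_le_mul_of_nonneg_right (le_abs_self K) h4).trans ?_)
  exact mul_le_mul_of_nonneg_left h3 (abs_nonneg _)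

end Sit

section polar

lemma integral_volIoi {F : Type*} [NormedAddCommGroup F] [NormedSpace ℝ F] (n : ℕ) (H : ℝ → F) :
    ∫ t : Ioi (0 : ℝ), H t ∂(Measure.volumeIoiPow n) = ∫ t in Ioi (0 : ℝ), t ^ n • H t := by
  simp only [Measure.volumeIoiPow, ENNReal.ofReal]
  rw [integral_withDensity_eq_integral_smul,
    integral_subtype_comap measurableSet_Ioi fun a ↦ Real.toNNReal (a ^ n) • H a,
    setIntegral_congr_fun measurableSet_Ioi fun x hx ↦ ?_]
  · rw [NNReal.smul_def, Real.coe_toNNReal _ (pow_nonneg hx.out.le _)]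
  · exact (measurable_subtype_coe.pow_const _).real_toNNReal

variable {V : Type*} [NormedAddCommGroup V] [NormedSpace ℝ V] [MeasurableSpace V] [BorelSpace V]
  [FiniteDimensional ℝ V] [Nontrivial V] (μ : Measure V) [μ.IsAddHaarMeasure]

lemma polar_aux {F : Type*} [NormedAddCommGroup F] [NormedSpace ℝ F] (f : V → F) :
    (∫ x, f x ∂μ = ∫ p : sphere (0 : V) 1 × Ioi (0 : ℝ), f (p.2.1 • p.1.1)
      ∂(μ.toSphere.prod (.volumeIoiPow (Module.finrank ℝ V - 1)))) ∧
    (Integrable f μ → Integrable (fun p : sphere (0 : V) 1 × Ioi (0 : ℝ) => f (p.2.1 • p.1.1))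
      (μ.toSphere.prod (.volumeIoiPow (Module.finrank ℝ V - 1)))) := by
  have hx : ∀ x : ({0}ᶜ : Set V), f ((homeomorphUnitSphereProd V x).2.1 •
      (homeomorphUnitSphereProd V x).1.1) = f x := by
    intro x
    have : ‖(x : V)‖ ≠ 0 := norm_ne_zero_iff.2 x.2
    simp [smul_smul, this]
  constructor
  · have h1 := μ.measurePreserving_homeomorphUnitSphereProd.integral_comp
        (Homeomorph.measurableEmbedding _) (fun p : sphere (0 : V) 1 × Ioi (0 : ℝ) => f (p.2.1 • p.1.1))
    rw [← h1]
    simp only [hx]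
    rw [integral_subtype_comap (measurableSet_singleton _).compl fun x ↦ f x,
        restrict_compl_singleton]
  · intro hf
    have h1 := μ.measurePreserving_homeomorphUnitSphereProd.integrable_comp_emb
      (g := (fun p : sphere (0 : V) 1 × Ioi (0 : ℝ) => f (p.2.1 • p.1.1)))
      (Homeomorph.measurableEmbedding _)
    rw [← h1]
    have : (fun p : sphere (0 : V) 1 × Ioi (0 : ℝ) => f (p.2.1 • p.1.1)) ∘
      (homeomorphUnitSphereProd V) = f ∘ Subtype.val := by
      ext x; exact hx x
    rw [this, ← integrableOn_iff_comap_subtypeVal (measurableSet_singleton _).compl]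
    exact hf.integrableOn

lemma polar_bound {F : V → ℂ} {G : V → ℝ} (hF : Integrable F μ) (hG : Integrable G μ) (C : ℝ)
    (h : ∀ v : V, ‖v‖ = 1 → ‖∫ t in Ioi (0 : ℝ), t ^ (Module.finrank ℝ V - 1) • F (t • v)‖ ≤
      C * ∫ t in Ioi (0 : ℝ), t ^ (Module.finrank ℝ V - 1) • G (t • v)) :
    ‖∫ x, F x ∂μ‖ ≤ C * ∫ x, G x ∂μ := by
  rw [(polar_aux μ F).1, (polar_aux μ G).1, integral_prod _ ((polar_aux μ F).2 hF),
    integral_prod _ ((polar_aux μ G).2 hG), ← integral_const_mul]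
  refine norm_integral_le_of_norm_le (((polar_aux μ G).2 hG).integral_prod_left.const_mul C)
    (Eventually.of_forall fun v => ?_)
  have h1 := integral_volIoi (Module.finrank ℝ V - 1) (fun t => F (t • (v : V)))
  have h2 := integral_volIoi (Module.finrank ℝ V - 1) (fun t => G (t • (v : V)))
  have h3 := h v (by simp)
  rw [← h1, ← h2] at h3
  exact h3

end polar

section radial
variable {d : ℕ}

lemma radialPow_contDiff {m : ℕ} {ψ : EuclideanSpace ℝ (Fin d) → ℝ} (hψ : ContDiff ℝ (m : ℕ∞) ψ)
    (k j : ℕ) (hk : k + j ≤ m) : ContDiff ℝ (j : ℕ∞) (radialPow k ψ) := by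
  induction k generalizing j with
  | zero => exact hψ.of_le (by exact_mod_cast (by omega))
  | succ k ih =>
    have h1 := ih (j + 1) (by omega)
    have h2 : ContDiff ℝ (j : ℕ∞) (fderiv ℝ (radialPow k ψ)) :=
      h1.fderiv_right (by exact_mod_cast le_rfl)
    exact h2.clm_apply contDiff_id

lemma radialPow_tsupport (ψ : EuclideanSpace ℝ (Fin d) → ℝ) (k : ℕ) :
    tsupport (radialPow k ψ) ⊆ tsupport ψ := by
  induction k with
  | zero => exact subset_rfl
  | succ k ih =>
    refine Subset.trans (closure_minimal ?_ (isClosed_tsupport _)) ih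
    intro x hx
    by_contra h
    apply hx
    have : fderiv ℝ (radialPow k ψ) x = 0 := by
      by_contra h'
      exact h (support_fderiv_subset ℝ h')
    simp [radialPow, this]

lemma radialPow_zero (ψ : EuclideanSpace ℝ (Fin d) → ℝ) (k : ℕ) {x : EuclideanSpace ℝ (Fin d)}
    (hx : x ∉ tsupport ψ) : radialPow k ψ x = 0 :=
  image_eq_zero_of_notMem_tsupport fun h => hx (radialPow_tsupport ψ k h)

lemma radialPow_ray {ψ : EuclideanSpace ℝ (Fin d) → ℝ} {k : ℕ} (h : ContDiff ℝ (1 : ℕ) (radialPow k ψ))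
    (v : EuclideanSpace ℝ (Fin d)) {t : ℝ} (ht : t ≠ 0) :
    HasDerivAt (fun t : ℝ => radialPow k ψ (t • v)) (radialPow (k + 1) ψ (t • v) / t) t := by
  have h1 := (h.differentiable (by simp) (t • v)).hasFDerivAt
  have h2 : HasDerivAt (fun t : ℝ => t • v) v t := by
    simpa using (hasDerivAt_id t).smul_const v
  refine (h1.comp_hasDerivAt t h2).congr_deriv ?_
  simp only [radialPow, map_smul, smul_eq_mul]
  field_simp

lemma cont_glue {Y : Type*} [TopologicalSpace Y] [Zero Y] {Ω K : Set (EuclideanSpace ℝ (Fin d))}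
    (hΩ : IsOpen Ω) (hK : IsClosed K) (hKΩ : K ⊆ Ω) {h : EuclideanSpace ℝ (Fin d) → Y}
    (hc : ContinuousOn h Ω) (h0 : ∀ x ∉ K, h x = 0) : Continuous h := by
  rw [continuous_iff_continuousAt]
  intro x
  by_cases hx : x ∈ Ω
  · exact hc.continuousAt (hΩ.mem_nhds hx)
  · have : x ∈ Kᶜ := fun h => hx (hKΩ h)
    have h1 : h =ᶠ[𝓝 x] fun _ => 0 := by
      filter_upwards [hK.isOpen_compl.mem_nhds this] with y hy using h0 y hy
    exact continuousAt_const.congr h1.symm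

lemma f_nonneg {Ω : Set (EuclideanSpace ℝ (Fin d))} {f : EuclideanSpace ℝ (Fin d) → ℝ}
    (h0 : (0 : EuclideanSpace ℝ (Fin d)) ∈ Ω) (hf : ConvexOn ℝ Ω f) (f0 : f 0 = 0)
    (hd : HasFDerivAt f (0 : EuclideanSpace ℝ (Fin d) →L[ℝ] ℝ) 0) {x : EuclideanSpace ℝ (Fin d)}
    (hx : x ∈ Ω) : 0 ≤ f x := by
  have h2 : HasDerivAt (fun t : ℝ => t • x) x 0 := by
    simpa using (hasDerivAt_id (0:ℝ)).smul_const x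
  have hd' : HasFDerivAt f (0 : EuclideanSpace ℝ (Fin d) →L[ℝ] ℝ) ((0 : ℝ) • x) := by simpa using hd
  have h3 := hd'.comp_hasDerivAt 0 h2
  have h4 := h3.tendsto_slope_zero_right
  simp only [zero_add, Function.comp, zero_smul, f0, sub_zero, ContinuousLinearMap.zero_apply] at h4
  refine le_of_tendsto h4 ?_
  filter_upwards [Ioo_mem_nhdsGT (zero_lt_one (α := ℝ))] with t ht
  have := hf.2 h0 hx (show (0:ℝ) ≤ 1 - t by linarith [ht.2]) ht.1.le (show 1 - t + t = 1 by ring)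
  simp [f0] at this
  rw [smul_eq_mul, inv_mul_le_iff₀ ht.1]
  exact this

end radial

section ray
variable {d : ℕ}

lemma exists_b {Ω : Set (EuclideanSpace ℝ (Fin d))} (hΩ : IsOpen Ω)
    (h0 : (0 : EuclideanSpace ℝ (Fin d)) ∈ Ω) {ψ : EuclideanSpace ℝ (Fin d) → ℝ}
    (hψ : HasCompactSupport ψ) (hs : tsupport ψ ⊆ Ω) {v : EuclideanSpace ℝ (Fin d)} (hv : ‖v‖ = 1) :
    ∃ b : ℝ, 0 < b ∧ b • v ∈ Ω ∧ ∀ t, b ≤ t → t • v ∉ tsupport ψ := by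
  have hc : Continuous fun t : ℝ => t • v := by fun_prop
  set T : Set ℝ := insert 0 ((fun t : ℝ => t • v) ⁻¹' tsupport ψ) with hT
  have hTc : IsCompact T := by
    refine IsCompact.insert ?_ 0
    obtain ⟨R, hR⟩ := hψ.isCompact.isBounded.exists_norm_le
    refine Metric.isCompact_of_isClosed_isBounded ((isClosed_tsupport _).preimage hc) ?_
    refine isBounded_iff_forall_norm_le.2 ⟨R, fun t ht => ?_⟩
    have := hR _ ht
    simpa [norm_smul, hv] using this
  have hT0 : (0 : ℝ) ∈ T := mem_insert _ _
  have hmem := hTc.sSup_mem ⟨0, hT0⟩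
  set t1 := sSup T
  have hle : ∀ t ∈ T, t ≤ t1 := fun t ht => le_csSup hTc.bddAbove ht
  have hU : t1 • v ∈ Ω := by
    rcases hmem with h | h
    · rw [h]; simpa using h0
    · exact hs h
  have h1 : ∀ᶠ t in 𝓝[>] t1, t • v ∈ Ω :=
    nhdsWithin_le_nhds ((hΩ.preimage hc).mem_nhds hU)
  obtain ⟨b, hb, hb1⟩ := (h1.and self_mem_nhdsWithin).exists
  have hb1' : t1 < b := hb1
  refine ⟨b, lt_of_le_of_lt (hle 0 hT0) hb1, hb, fun t ht hts => ?_⟩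
  have := hle t (mem_insert_of_mem _ hts)
  linarith

lemma raySet_convex {Ω : Set (EuclideanSpace ℝ (Fin d))} (hΩ : Convex ℝ Ω)
    (v : EuclideanSpace ℝ (Fin d)) : Convex ℝ (raySet Ω v) := by
  have h1 : raySet Ω v = Ici 0 ∩ (LinearMap.toSpanSingleton ℝ _ v) ⁻¹' Ω := by
    ext t; simp [raySet]
  rw [h1]
  exact (convex_Ici 0).inter (hΩ.linear_preimage _)

lemma ray_convexOn {Ω : Set (EuclideanSpace ℝ (Fin d))} (hΩ : Convex ℝ Ω)
    {f : EuclideanSpace ℝ (Fin d) → ℝ} (hf : ConvexOn ℝ Ω f)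
    (v : EuclideanSpace ℝ (Fin d)) : ConvexOn ℝ (raySet Ω v) (fun t : ℝ => f (t • v)) :=
  (hf.comp_linearMap (LinearMap.toSpanSingleton ℝ _ v)).subset (fun t ht => by simpa using ht.2)
    (raySet_convex hΩ v)

end ray

section ray2
variable {d : ℕ}

lemma mk_sit {m : ℕ} (hm : 2 ≤ m) {C₀ : ℝ} {Ω : Set (EuclideanSpace ℝ (Fin d))}
    {f : EuclideanSpace ℝ (Fin d) → ℝ} (hΩ : IsOpen Ω) (hΩc : Convex ℝ Ω)
    (h0 : (0 : EuclideanSpace ℝ (Fin d)) ∈ Ω)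
    (hf : ConvexOn ℝ Ω f) (ht : UniformlyRadiallyTame Ω f m C₀)
    {ψ : EuclideanSpace ℝ (Fin d) → ℝ} (hψ : ContDiff ℝ (m : ℕ∞) ψ)
    {v : EuclideanSpace ℝ (Fin d)} (hv : ‖v‖ = 1) (lam : ℝ) {a b : ℝ} (ha : 0 ≤ a) (hab : a < b)
    (hb : b • v ∈ Ω) (hbs : b • v ∉ tsupport ψ) (hfa : f (a • v) = 0)
    (hpos : ∀ t, a < t → t ≤ b → 0 < f (t • v)) :
    ∃ S : Sit m C₀, S.g 0 = (fun t => f (t • v)) ∧ S.φ = (fun i t => radialPow i ψ (t • v)) ∧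
      S.a = a ∧ S.b = b ∧ S.lam = lam := by
  obtain ⟨hcd, htame⟩ := ht v hv
  have hb0 : 0 < b := ha.trans_lt hab
  have hrc := raySet_convex hΩc v
  have hsub : Icc 0 b ⊆ raySet Ω v := by
    have h1 : (0:ℝ) ∈ raySet Ω v := ⟨le_rfl, by simpa using h0⟩
    have h2 : b ∈ raySet Ω v := ⟨hb0.le, hb⟩
    exact hrc.ordConnected.out h1 h2
  have hnh : ∀ t ∈ Ioo a b, raySet Ω v ∈ 𝓝 t := fun t ht =>
    mem_of_superset (Icc_mem_nhds (ha.trans_lt ht.1) ht.2) hsub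
  have hud : UniqueDiffOn ℝ (raySet Ω v) := by
    refine uniqueDiffOn_convex hrc ⟨(a + b) / 2, ?_⟩
    exact mem_interior_iff_mem_nhds.2 (hnh _ ⟨by linarith, by linarith⟩)
  have hmem : ∀ t ∈ Ioo a b, t ∈ raySet Ω v := fun t ht => mem_of_mem_nhds (hnh t ht)
  have hg0 : iteratedDerivWithin 0 (fun s : ℝ => f (s • v)) (raySet Ω v) = fun s => f (s • v) :=
    iteratedDerivWithin_zero
  have gder : ∀ k < m, ∀ t ∈ Ioo a b,
      HasDerivAt (iteratedDerivWithin k (fun s : ℝ => f (s • v)) (raySet Ω v))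
        (iteratedDerivWithin (k+1) (fun s : ℝ => f (s • v)) (raySet Ω v) t) t := by
    intro k hk t ht
    have h1 := hcd.differentiableOn_iteratedDerivWithin (m := k) (by exact_mod_cast hk) hud
    rw [iteratedDerivWithin_succ]
    exact (h1 t (hmem t ht)).hasDerivWithinAt.hasDerivAt (hnh t ht)
  have hcv := ray_convexOn hΩc hf v
  have gpos : ∀ t ∈ Ioo a b, 0 < f (t • v) := fun t ht => hpos t ht.1 ht.2.le
  have gslope : ∀ t ∈ Ioo a b, f (t • v) ≤ (t - a) *
      iteratedDerivWithin 1 (fun s : ℝ => f (s • v)) (raySet Ω v) t := by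
    intro t ht
    have h1 := gder 0 (by omega) t ht
    rw [hg0] at h1
    have h2 := hcv.slope_le_of_hasDerivAt (hsub ⟨ha, hab.le⟩) (hmem t ht) ht.1 h1
    rw [slope_def_field, hfa, sub_zero, div_le_iff₀ (by linarith [ht.1])] at h2
    simp only [zero_add] at h2
    linarith
  have g1pos : ∀ t ∈ Ioo a b, 0 < iteratedDerivWithin 1 (fun s : ℝ => f (s • v)) (raySet Ω v) t := by
    intro t ht
    have h1 := (gpos t ht).trans_le (gslope t ht)
    exact pos_of_mul_pos_right h1 (by linarith [ht.1])
  refine ⟨{ g := fun k => iteratedDerivWithin k (fun s : ℝ => f (s • v)) (raySet Ω v)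
            φ := fun i t => radialPow i ψ (t • v)
            a := a
            b := b
            lam := lam
            ha := ha
            hab := hab
            gder := gder
            gcont := ?_
            gpos := ?_
            gslope := ?_
            gbdd := ?_
            gtame := ?_
            φcont := ?_
            φder := ?_
            φb := ?_ }, hg0, rfl, rfl, rfl, rfl⟩
  · intro k hk
    exact (hcd.continuousOn_iteratedDerivWithin (by exact_mod_cast hk) hud).mono hmem
  · intro t ht; rw [hg0]; exact gpos t ht
  · intro t ht; rw [hg0]; exact gslope t ht
  · obtain ⟨M, hM⟩ := (isCompact_Icc (a := (0:ℝ)) (b := b)).bddAbove_image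
      (hcd.continuousOn.mono hsub)
    refine ⟨M, fun t ht => ?_⟩
    rw [hg0]
    exact hM ⟨t, ⟨(ha.trans_lt ht.1).le, ht.2.le⟩, rfl⟩
  · intro k h2 hk t ht
    have := htame k h2 hk t (hmem t ht)
    rw [← iteratedDerivWithin_one, abs_of_pos (gpos t ht), abs_of_pos (g1pos t ht)] at this
    rw [hg0]; exact this
  · intro i hi
    exact (radialPow_contDiff hψ i 0 (by omega)).continuous.comp (by fun_prop)
  · intro i hi t ht
    exact radialPow_ray (by exact_mod_cast radialPow_contDiff hψ i 1 (by omega)) v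
      (ha.trans_lt ht.1).ne'
  · intro i _
    exact radialPow_zero ψ i hbs

lemma ray_bound {m : ℕ} (hm : 2 ≤ m) {C₀ K : ℝ} {e ℓ : ℕ}
    (hK : ∀ S : Sit m C₀, ‖∫ t in S.a..S.b, S.E t * ((t^e * (S.g 0 t^ℓ * S.φ 0 t) : ℝ) : ℂ)‖ ≤
      K * ∫ t in S.a..S.b, t^e * (S.g 0 t^ℓ * ∑ j ∈ Finset.range m, |S.φ j t|) /
        (1 + |S.lam * S.g 0 t|)^(m-1))
    {Ω : Set (EuclideanSpace ℝ (Fin d))}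
    {f : EuclideanSpace ℝ (Fin d) → ℝ} (hΩ : IsOpen Ω) (hΩc : Convex ℝ Ω)
    (h0 : (0 : EuclideanSpace ℝ (Fin d)) ∈ Ω)
    (hf : ConvexOn ℝ Ω f) (f0 : f 0 = 0) (fn : ∀ x ∈ Ω, 0 ≤ f x) (hT : UniformlyRadiallyTame Ω f m C₀)
    {ψ : EuclideanSpace ℝ (Fin d) → ℝ} (hψ : ContDiff ℝ (m : ℕ∞) ψ) (hψc : HasCompactSupport ψ)
    (hs : tsupport ψ ⊆ Ω) (lam : ℝ)
    (F : EuclideanSpace ℝ (Fin d) → ℂ) (G : EuclideanSpace ℝ (Fin d) → ℝ)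
    (hF : ∀ x, F x = Complex.exp (Complex.I * ((lam * f x : ℝ) : ℂ)) * ((f x ^ ℓ * ψ x : ℝ) : ℂ))
    (hG : ∀ x, G x = |f x| ^ ℓ * (∑ k ∈ Finset.range m, |radialPow k ψ x|) /
                (1 + |lam * f x|) ^ (m - 1))
    (hFc : Continuous F) (hGc : Continuous G)
    {v : EuclideanSpace ℝ (Fin d)} (hv : ‖v‖ = 1) :
    ‖∫ t in Ioi (0 : ℝ), t ^ e • F (t • v)‖ ≤ max 1 K * ∫ t in Ioi (0 : ℝ), t ^ e • G (t • v) := by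
  obtain ⟨b, hb0, hb, hbs⟩ := exists_b hΩ h0 hψc hs hv
  have hray : ∀ t, 0 ≤ t → t ≤ b → t • v ∈ Ω := by
    have h1 : (0:ℝ) ∈ raySet Ω v := ⟨le_rfl, by simpa using h0⟩
    have h2 : b ∈ raySet Ω v := ⟨hb0.le, hb⟩
    intro t h3 h4
    exact ((raySet_convex hΩc v).ordConnected.out h1 h2 ⟨h3, h4⟩).2
  have F0 : ∀ x, x ∉ tsupport ψ → F x = 0 := fun x hx => by
    rw [hF, image_eq_zero_of_notMem_tsupport hx]; simp
  have G0 : ∀ x, x ∉ tsupport ψ → G x = 0 := fun x hx => by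
    rw [hG, Finset.sum_eq_zero]
    · simp
    · intro k _; rw [radialPow_zero ψ k hx, abs_zero]
  have Gnn : ∀ x, 0 ≤ G x := fun x => by rw [hG]; positivity
  have hFr : Continuous fun t : ℝ => t ^ e • F (t • v) := by fun_prop
  have hGr : Continuous fun t : ℝ => t ^ e • G (t • v) := by fun_prop
  have eF : ∫ t in Ioi (0 : ℝ), t ^ e • F (t • v) = ∫ t in (0:ℝ)..b, t ^ e • F (t • v) := by
    rw [intervalIntegral.integral_of_le hb0.le]
    refine (setIntegral_eq_of_subset_of_forall_sdiff_eq_zero measurableSet_Ioi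
      Ioc_subset_Ioi_self fun t ht => ?_)
    have : b ≤ t := by
      by_contra h
      exact ht.2 ⟨ht.1, (not_le.1 h).le⟩
    rw [F0 _ (hbs t this), smul_zero]
  have eG : ∫ t in Ioi (0 : ℝ), t ^ e • G (t • v) = ∫ t in (0:ℝ)..b, t ^ e • G (t • v) := by
    rw [intervalIntegral.integral_of_le hb0.le]
    refine (setIntegral_eq_of_subset_of_forall_sdiff_eq_zero measurableSet_Ioi
      Ioc_subset_Ioi_self fun t ht => ?_)
    have : b ≤ t := by
      by_contra h
      exact ht.2 ⟨ht.1, (not_le.1 h).le⟩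
    rw [G0 _ (hbs t this), smul_zero]
  rw [eF, eG]
  -- the zero set
  have hfc : ContinuousOn (fun t : ℝ => f (t • v)) (Icc 0 b) :=
    (hf.continuousOn hΩ).comp (by fun_prop) fun t ht => hray t ht.1 ht.2
  have hZc : IsCompact (Icc 0 b ∩ (fun t : ℝ => f (t • v)) ⁻¹' {0}) :=
    isCompact_Icc.of_isClosed_subset
      (hfc.preimage_isClosed_of_isClosed isClosed_Icc isClosed_singleton) inter_subset_left
  set Z := Icc 0 b ∩ (fun t : ℝ => f (t • v)) ⁻¹' {0} with hZ
  have hZ0 : (0:ℝ) ∈ Z := ⟨⟨le_rfl, hb0.le⟩, by simp [f0]⟩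
  have haZ := hZc.sSup_mem ⟨0, hZ0⟩
  have hle : ∀ t ∈ Z, t ≤ sSup Z := fun t ht => le_csSup hZc.bddAbove ht
  set a := sSup Z with ha_def
  obtain ⟨⟨ha, hab⟩, hfa⟩ := haZ
  have hfa : f (a • v) = 0 := hfa
  have hz : ∀ t, 0 ≤ t → t ≤ a → f (t • v) = 0 := by
    intro t h1 h2
    refine le_antisymm ?_ (fn _ (hray t h1 (h2.trans hab)))
    have hcv := ray_convexOn hΩc hf v
    have h3 := hcv.le_max_of_mem_Icc (x := 0) (y := a) (z := t) ⟨le_rfl, by simpa using h0⟩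
      ⟨ha, hray a ha hab⟩ ⟨h1, h2⟩
    simpa [f0, hfa] using h3
  have hpos : ∀ t, a < t → t ≤ b → 0 < f (t • v) := by
    intro t h1 h2
    refine lt_of_le_of_ne (fn _ (hray t (ha.trans h1.le) h2)) fun h => ?_
    have := hle t ⟨⟨ha.trans h1.le, h2⟩, h.symm⟩
    linarith
  have hi1 : ∀ x y, IntervalIntegrable (fun t : ℝ => t ^ e • F (t • v)) volume x y :=
    fun x y => hFr.intervalIntegrable x y
  have hi2 : ∀ x y, IntervalIntegrable (fun t : ℝ => t ^ e • G (t • v)) volume x y :=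
    fun x y => hGr.intervalIntegrable x y
  rw [← intervalIntegral.integral_add_adjacent_intervals (hi1 0 a) (hi1 a b),
    ← intervalIntegral.integral_add_adjacent_intervals (hi2 0 a) (hi2 a b), mul_add]
  refine (norm_add_le _ _).trans (add_le_add ?_ ?_)
  · have h1 : ‖∫ t in (0:ℝ)..a, t ^ e • F (t • v)‖ ≤ ∫ t in (0:ℝ)..a, t ^ e • G (t • v) := by
      refine intervalIntegral.norm_integral_le_of_norm_le ha (Eventually.of_forall fun t ht => ?_)
        (hi2 0 a)
      have hft := hz t ht.1.le ht.2
      rw [norm_smul, smul_eq_mul, Real.norm_eq_abs, abs_of_nonneg (pow_nonneg ht.1.le e)]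
      refine mul_le_mul_of_nonneg_left ?_ (pow_nonneg ht.1.le e)
      rw [hF, hG, hft]
      simp only [mul_zero, Complex.ofReal_zero, Complex.exp_zero, one_mul, abs_zero, add_zero,
        one_pow, div_one, Complex.norm_real, Real.norm_eq_abs, abs_mul, abs_pow]
      refine mul_le_mul_of_nonneg_left ?_ (by positivity)
      exact Finset.single_le_sum (f := fun k => |radialPow k ψ (t • v)|)
        (fun _ _ => abs_nonneg _) (Finset.mem_range.2 (by omega : 0 < m))
    refine h1.trans (le_mul_of_one_le_left ?_ (le_max_left _ _))
    exact intervalIntegral.integral_nonneg ha fun t ht => smul_nonneg (pow_nonneg ht.1 e) (Gnn _)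
  · rcases hab.eq_or_lt with h | h
    · rw [h]; simp
    · obtain ⟨S, hg, hφ, hSa, hSb, hSl⟩ := mk_sit hm hΩ hΩc h0 hf hT hψ hv lam ha h hb
        (hbs b le_rfl) hfa hpos
      have h1 := hK S
      rw [hSa, hSb] at h1
      have e1 : ∫ t in a..b, S.E t * ((t^e * (S.g 0 t^ℓ * S.φ 0 t) : ℝ) : ℂ) =
          ∫ t in a..b, t ^ e • F (t • v) := by
        refine intervalIntegral.integral_congr fun t _ => ?_
        simp only [Sit.E, hg, hφ, hSl, hF, radialPow, Complex.real_smul]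
        push_cast
        ring
      have e2 : ∫ t in a..b, t^e * (S.g 0 t^ℓ * ∑ j ∈ Finset.range m, |S.φ j t|) /
        (1 + |S.lam * S.g 0 t|)^(m-1) = ∫ t in a..b, t ^ e • G (t • v) := by
        refine intervalIntegral.integral_congr fun t ht => ?_
        rw [uIcc_of_le hab] at ht
        simp only [hg, hφ, hSl, hG, smul_eq_mul,
          abs_of_nonneg (fn _ (hray t (ha.trans ht.1) ht.2))]
        ring
      rw [e1, e2] at h1
      refine h1.trans (mul_le_mul_of_nonneg_right (le_max_right _ _) ?_)
      exact intervalIntegral.integral_nonneg hab fun t ht =>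
        smul_nonneg (pow_nonneg (ha.trans ht.1) e) (Gnn _)

end ray2

end helpers

/-- for `m ≥ 2` and a convex `f` on an open convex `Ω ∋ 0` with
`f(0) = 0`, `∇f(0) = 0`, which is uniformly radially tame to order `m` with
constant `C₀`, one has for all compactly supported `ψ ∈ C^m(Ω)`, all real `λ`,
and all `ℓ ≥ 0`:
`|∫_Ω e^{iλf} f^ℓ ψ| ≤ C ∫_Ω |f|^ℓ Σ_{k<m} |(x·∇)^k ψ| / (1+|λf|)^{m-1}`,
with `C` depending only on `m`, `d`, `ℓ`, `C₀`. -/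
theorem statement_2 (d m ℓ : ℕ) (C₀ : ℝ) (hm : 2 ≤ m) :
    ∃ C : ℝ, 0 < C ∧
      ∀ (Ω : Set (EuclideanSpace ℝ (Fin d))) (f : EuclideanSpace ℝ (Fin d) → ℝ),
        IsOpen Ω → Convex ℝ Ω → (0 : EuclideanSpace ℝ (Fin d)) ∈ Ω →
        ConvexOn ℝ Ω f → f 0 = 0 →
        HasFDerivAt f (0 : EuclideanSpace ℝ (Fin d) →L[ℝ] ℝ) 0 →
        UniformlyRadiallyTame Ω f m C₀ →
        ∀ ψ : EuclideanSpace ℝ (Fin d) → ℝ,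
          ContDiff ℝ (m : ℕ∞) ψ → HasCompactSupport ψ → tsupport ψ ⊆ Ω →
        ∀ lam : ℝ,
          ‖∫ x in Ω, Complex.exp (Complex.I * ((lam * f x : ℝ) : ℂ)) *
              ((f x ^ ℓ * ψ x : ℝ) : ℂ)‖ ≤
            C * ∫ x in Ω,
              |f x| ^ ℓ * (∑ k ∈ Finset.range m, |radialPow k ψ x|) /
                (1 + |lam * f x|) ^ (m - 1) := by

  obtain ⟨K, -, hK⟩ := Sit.oneD hm C₀ (d - 1) ℓ
  refine ⟨max 1 K, lt_max_of_lt_left one_pos, ?_⟩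
  intro Ω f hΩ hΩc h0 hf f0 hd hT ψ hψ hψc hs lam
  have fn : ∀ x ∈ Ω, 0 ≤ f x := fun x hx => f_nonneg h0 hf f0 hd hx
  set F : EuclideanSpace ℝ (Fin d) → ℂ := fun x =>
    Complex.exp (Complex.I * ((lam * f x : ℝ) : ℂ)) * ((f x ^ ℓ * ψ x : ℝ) : ℂ) with hF
  set G : EuclideanSpace ℝ (Fin d) → ℝ := fun x =>
    |f x| ^ ℓ * (∑ k ∈ Finset.range m, |radialPow k ψ x|) / (1 + |lam * f x|) ^ (m - 1) with hG
  have F0 : ∀ x, x ∉ tsupport ψ → F x = 0 := fun x hx => by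
    simp only [hF]
    rw [image_eq_zero_of_notMem_tsupport hx]; simp
  have G0 : ∀ x, x ∉ tsupport ψ → G x = 0 := fun x hx => by
    simp only [hG]
    rw [Finset.sum_eq_zero]
    · simp
    · intro k _; rw [radialPow_zero ψ k hx, abs_zero]
  have hfc : ContinuousOn f Ω := hf.continuousOn hΩ
  have hFc : Continuous F := by
    refine cont_glue hΩ (isClosed_tsupport ψ) hs ?_ F0
    have h1 : ContinuousOn (fun x => ((lam * f x : ℝ) : ℂ)) Ω :=
      Complex.continuous_ofReal.comp_continuousOn (continuousOn_const.mul hfc)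
    have h2 : ContinuousOn (fun x => ((f x ^ ℓ * ψ x : ℝ) : ℂ)) Ω :=
      Complex.continuous_ofReal.comp_continuousOn ((hfc.pow ℓ).mul hψ.continuous.continuousOn)
    exact (Complex.continuous_exp.comp_continuousOn (continuousOn_const.mul h1)).mul h2
  have hGc : Continuous G := by
    refine cont_glue hΩ (isClosed_tsupport ψ) hs ?_ G0
    refine ContinuousOn.div ?_ ?_ ?_
    · refine (hfc.abs.pow ℓ).mul (continuousOn_finset_sum _ fun k hk => ?_)
      have hk := Finset.mem_range.1 hk
      exact (radialPow_contDiff hψ k 0 (by omega)).continuous.continuousOn.abs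
    · exact (continuousOn_const.add (continuousOn_const.mul hfc).abs).pow _
    · intro x _; positivity
  have hFi : Integrable F := hFc.integrable_of_hasCompactSupport
    (HasCompactSupport.intro hψc.isCompact F0)
  have hGi : Integrable G := hGc.integrable_of_hasCompactSupport
    (HasCompactSupport.intro hψc.isCompact G0)
  have eF : ∫ x in Ω, F x = ∫ x, F x :=
    setIntegral_eq_integral_of_forall_compl_eq_zero fun x hx => F0 x fun h => hx (hs h)
  have eG : ∫ x in Ω, G x = ∫ x, G x :=
    setIntegral_eq_integral_of_forall_compl_eq_zero fun x hx => G0 x fun h => hx (hs h)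
  rw [eF, eG]
  rcases Nat.eq_zero_or_pos d with hd0 | hdpos
  · subst hd0
    have h1 : ‖∫ x, F x‖ ≤ ∫ x, G x := by
      refine norm_integral_le_of_norm_le hGi (Filter.Eventually.of_forall fun x => ?_)
      have hx : x = 0 := Subsingleton.elim _ _
      have hft : f x = 0 := by rw [hx, f0]
      simp only [hF, hG, hft]
      simp only [mul_zero, Complex.ofReal_zero, Complex.exp_zero, one_mul, abs_zero, add_zero,
        one_pow, div_one, Complex.norm_real, Real.norm_eq_abs, abs_mul, abs_pow]
      refine mul_le_mul_of_nonneg_left ?_ (by positivity)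
      exact Finset.single_le_sum (f := fun k => |radialPow k ψ x|)
        (fun _ _ => abs_nonneg _) (Finset.mem_range.2 (by omega : 0 < m))
    refine h1.trans (le_mul_of_one_le_left ?_ (le_max_left _ _))
    exact integral_nonneg fun x => by simp only [hG]; positivity
  · haveI : Nonempty (Fin d) := ⟨⟨0, hdpos⟩⟩
    refine polar_bound volume hFi hGi _ fun v hv => ?_
    rw [finrank_euclideanSpace_fin]
    exact ray_bound hm hK hΩ hΩc h0 hf f0 fn hT hψ hψc hs lam F G (fun _ => rfl) (fun _ => rfl)
      hFc hGc hv
end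

section
/- Let f be a convex polynomial function on a convex open set Ω ⊂ R^d containing the origin, with f(0) = 0 and ∇f(0) = 0. Then for every m ≥ 2, f is uniformly radially tame to order m on Ω with a constant depending only on the degree of f and on m (in particular, the constant is independent of f itself and of Ω). -/
open Metric Set

open Polynomial in
theorem aux_comp (q : ℝ[X]) (t : ℝ) (k : ℕ) :
    derivative^[k] (q.comp (C t * X)) = C (t ^ k) * (derivative^[k] q).comp (C t * X) := by
  induction k with
  | zero => simp
  | succ k ih =>
    rw [Function.iterate_succ_apply', ih, Function.iterate_succ_apply']
    simp only [derivative_mul, derivative_C, derivative_comp, derivative_X, map_pow, zero_mul,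
      zero_add, mul_one]
    rw [← C_pow, derivative_C, C_pow]
    ring

open Polynomial in
theorem aux_bound (D k : ℕ) : ∃ K : ℝ, 0 ≤ K ∧ ∀ (q : ℝ[X]) (M : ℝ), q.natDegree ≤ D →
    (∀ x ∈ Set.Icc (0 : ℝ) 1, |q.eval x| ≤ M) → |(derivative^[k] q).eval 1| ≤ K * M := by
  classical
  let v : ℕ → ℝ := fun i => (i : ℝ) / (D + 1)
  have hD : (0 : ℝ) < D + 1 := by positivity
  have hv : Set.InjOn v (Finset.range (D + 1) : Finset ℕ) := by
    intro a _ b _ h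
    have : (a : ℝ) / (D + 1) = b / (D + 1) := h
    field_simp at this
    exact_mod_cast this
  refine ⟨∑ i ∈ Finset.range (D + 1),
    |(derivative^[k] (Lagrange.basis (Finset.range (D + 1)) v i)).eval 1|,
    Finset.sum_nonneg fun _ _ => abs_nonneg _, ?_⟩
  intro q M hq hM
  have hqi := Lagrange.eq_interpolate (f := q) hv (by
    rw [Finset.card_range]
    refine lt_of_le_of_lt degree_le_natDegree ?_
    exact_mod_cast Nat.lt_succ_of_le hq)
  rw [hqi, Lagrange.interpolate_apply, iterate_derivative_sum, eval_finsetSum, Finset.sum_mul]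
  refine (Finset.abs_sum_le_sum_abs _ _).trans (Finset.sum_le_sum fun i hi => ?_)
  rw [iterate_derivative_C_mul, eval_mul, eval_C, abs_mul, mul_comm]
  refine mul_le_mul_of_nonneg_left (hM _ ⟨by positivity, ?_⟩) (abs_nonneg _)
  rw [Finset.mem_range] at hi
  show (i : ℝ) / (D + 1) ≤ 1
  rw [div_le_one hD]
  exact_mod_cast hi.le

open Polynomial in
theorem aux_itd (P : ℝ[X]) (s : Set ℝ) (hs : UniqueDiffOn ℝ s) (k : ℕ) :
    ∀ t ∈ s, iteratedDerivWithin k (fun x => P.eval x) s t = (derivative^[k] P).eval t := by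
  induction k with
  | zero => intro t _; simp
  | succ k ih =>
    intro t ht
    rw [iteratedDerivWithin_succ, derivWithin_congr ih (ih t ht), Function.iterate_succ_apply']
    exact ((derivative^[k] P).hasDerivAt t).hasDerivWithinAt.derivWithin (hs t ht)

open Polynomial in
theorem aux_one (D k : ℕ) : ∃ K : ℝ, 0 ≤ K ∧ ∀ (P : ℝ[X]) (t : ℝ), P.natDegree ≤ D →
    0 < t → MonotoneOn (fun x => (derivative P).eval x) (Set.Icc 0 t) → P.eval 0 = 0 →
    (derivative P).eval 0 = 0 →
    |P.eval t| ^ k * |(derivative^[k + 1] P).eval t| ≤ K * |(derivative P).eval t| ^ (k + 1) := by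
  obtain ⟨K, hK, H⟩ := aux_bound D k
  refine ⟨K, hK, ?_⟩
  intro P t hP ht hmono h0 h0'
  have hpos : ∀ x ∈ Set.Icc 0 t, 0 ≤ (derivative P).eval x := fun x hx => by
    have := hmono ⟨le_rfl, ht.le⟩ hx hx.1
    simpa [h0'] using this
  have hle : ∀ x ∈ Set.Icc 0 t, (derivative P).eval x ≤ (derivative P).eval t := fun x hx =>
    hmono hx ⟨ht.le, le_rfl⟩ hx.2
  obtain ⟨c, hc, hce⟩ := exists_deriv_eq_slope (fun x => P.eval x) ht
    P.continuous.continuousOn P.differentiable.differentiableOn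
  rw [Polynomial.deriv] at hce
  simp only [h0, sub_zero] at hce
  have hPt : P.eval t = (derivative P).eval c * t := by rw [hce]; field_simp
  have hc' : c ∈ Set.Icc 0 t := ⟨hc.1.le, hc.2.le⟩
  have hA : |P.eval t| ≤ (derivative P).eval t * t := by
    rw [hPt, abs_of_nonneg (mul_nonneg (hpos c hc') ht.le)]
    exact mul_le_mul_of_nonneg_right (hle c hc') ht.le
  have hB := H ((derivative P).comp (C t * X)) ((derivative P).eval t) (by
      refine natDegree_comp_le.trans ?_
      have h1 : (C t * X : ℝ[X]).natDegree ≤ 1 := (natDegree_C_mul_le t X).trans natDegree_X_le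
      have h2 := natDegree_derivative_le P
      calc _ ≤ (derivative P).natDegree * 1 := Nat.mul_le_mul_left _ h1
        _ ≤ D := by omega) (by
      intro x hx
      have hx' : t * x ∈ Set.Icc 0 t :=
        ⟨mul_nonneg ht.le hx.1, mul_le_of_le_one_right ht.le hx.2⟩
      simp only [eval_comp, eval_mul, eval_C, eval_X]
      rw [abs_of_nonneg (hpos _ hx')]
      exact hle _ hx')
  rw [aux_comp] at hB
  simp only [eval_mul, eval_comp, eval_C, eval_X, mul_one, abs_mul] at hB
  rw [abs_of_nonneg (pow_nonneg ht.le k)] at hB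
  have hg := hpos t ⟨ht.le, le_rfl⟩
  rw [Function.iterate_succ_apply, abs_of_nonneg hg]
  calc _ ≤ ((derivative P).eval t * t) ^ k * |(derivative^[k] (derivative P)).eval t| := by gcongr
    _ = (derivative P).eval t ^ k * (t ^ k * |(derivative^[k] (derivative P)).eval t|) := by ring
    _ ≤ (derivative P).eval t ^ k * (K * (derivative P).eval t) := by gcongr
    _ = _ := by ring

theorem aux_diff {d : ℕ} (p : MvPolynomial (Fin d) ℝ) :
    Differentiable ℝ (fun x : EuclideanSpace ℝ (Fin d) => MvPolynomial.eval (fun i => x i) p) := by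
  induction p using MvPolynomial.induction_on with
  | C a => simp
  | add p q hp hq => simp only [map_add]; exact hp.add hq
  | mul_X p i hp =>
    simp only [map_mul, MvPolynomial.eval_X]
    exact hp.mul (by fun_prop)


/-- a convex polynomial `f` on an open convex `Ω ∋ 0` with
`f(0) = 0` and `∇f(0) = 0` is uniformly radially tame to any order `m ≥ 2` with
a constant depending only on the degree of `f` and on `m` (independent of `f`,
of `Ω`, and even of the dimension `d`). -/
theorem statement_3 (D m : ℕ) (hm : 2 ≤ m) :
    ∃ C : ℝ, 0 < C ∧
      ∀ (d : ℕ) (Ω : Set (EuclideanSpace ℝ (Fin d)))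
        (p : MvPolynomial (Fin d) ℝ),
        p.totalDegree ≤ D →
        IsOpen Ω → Convex ℝ Ω → (0 : EuclideanSpace ℝ (Fin d)) ∈ Ω →
        ConvexOn ℝ Ω (fun x => MvPolynomial.eval (fun i => x i) p) →
        MvPolynomial.eval (fun _ : Fin d => (0 : ℝ)) p = 0 →
        fderiv ℝ (fun x : EuclideanSpace ℝ (Fin d) =>
          MvPolynomial.eval (fun i => x i) p) 0 = 0 →
        UniformlyRadiallyTame Ω
          (fun x => MvPolynomial.eval (fun i => x i) p) m C := by
  choose K hK H using aux_one D
  refine ⟨∑ k ∈ Finset.range (m + 1), K k + 1,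
    by have := Finset.sum_nonneg (s := Finset.range (m + 1)) fun i _ => hK i; linarith, ?_⟩
  intro d Ω p hp hO hc h0 hconv hp0 hp0' v hv
  let P : Polynomial ℝ :=
    MvPolynomial.aeval (fun i => Polynomial.C (v i) * Polynomial.X) p
  have hPe : ∀ t : ℝ, MvPolynomial.eval (fun i => (t • v) i) p = P.eval t := by
    intro t
    simp only [P]
    rw [← Polynomial.coe_evalRingHom, MvPolynomial.aeval_def, MvPolynomial.hom_eval₂,
      MvPolynomial.eval]
    simp only [MvPolynomial.coe_eval₂Hom]
    congr 1
    · exact RingHom.ext fun x => by simp [Polynomial.algebraMap_eq]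
    · funext i
      simp only [PiLp.smul_apply, smul_eq_mul, Polynomial.coe_evalRingHom, Polynomial.eval_mul,
        Polynomial.eval_C, Polynomial.eval_X]
      exact mul_comm _ _
  have hPd : P.natDegree ≤ D := by
    have := MvPolynomial.aeval_natDegree_le p hp
      (fun i => Polynomial.C (v i) * Polynomial.X) (n := 1)
      (fun i => (Polynomial.natDegree_C_mul_le _ _).trans Polynomial.natDegree_X_le)
    simpa using this
  have hfe : (fun t : ℝ => MvPolynomial.eval (fun i => (t • v) i) p) = fun t => P.eval t :=
    funext hPe
  have hsc : Convex ℝ (raySet Ω v) := by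
    have h1 : Convex ℝ ((LinearMap.toSpanSingleton ℝ _ v) ⁻¹' Ω) := hc.linear_preimage _
    exact (convex_Ici (0 : ℝ)).inter h1
  have h0s : (0 : ℝ) ∈ raySet Ω v := ⟨le_rfl, by simpa using h0⟩
  have hopen : IsOpen {t : ℝ | t • v ∈ Ω} := hO.preimage (by fun_prop)
  have hint : (interior (raySet Ω v)).Nonempty := by
    obtain ⟨ε, hε, hb⟩ := Metric.isOpen_iff.1 hopen 0 (by simpa using h0)
    refine ⟨ε / 2, mem_interior.2 ⟨Set.Ioo 0 ε, ?_, isOpen_Ioo, by constructor <;> linarith⟩⟩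
    intro x hx
    refine ⟨hx.1.le, hb ?_⟩
    rw [Metric.mem_ball, Real.dist_eq, sub_zero, abs_of_pos hx.1]
    exact hx.2
  have hU : UniqueDiffOn ℝ (raySet Ω v) := uniqueDiffOn_convex hsc hint
  have hPc : ConvexOn ℝ (raySet Ω v) (fun t => P.eval t) := by
    have h1 := hconv.comp_linearMap (LinearMap.toSpanSingleton ℝ _ v)
    have h2 := h1.subset (fun t ht => ht.2) hsc
    rw [← hfe]
    exact h2
  have hmono : MonotoneOn (fun x => P.derivative.eval x) (raySet Ω v) := by
    have := hPc.monotoneOn_deriv (fun x _ => P.differentiable x)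
    intro a ha b hb hab
    simpa using this ha hb hab
  have hP0 : P.eval 0 = 0 := by rw [← hPe 0]; simpa using hp0
  have hP0' : P.derivative.eval 0 = 0 := by
    have h1 := (aux_diff p 0).hasFDerivAt
    rw [hp0'] at h1
    have h2 : HasDerivAt (fun t : ℝ => t • v) v 0 := by
      simpa using (hasDerivAt_id (0 : ℝ)).smul_const v
    have h3 := HasFDerivAt.comp_hasDerivAt_of_eq (0 : ℝ) h1 h2 (by simp)
    have h4 : HasDerivAt (fun t => P.eval t) 0 0 := by
      rw [← hfe]; exact h3
    exact (P.hasDerivAt 0).unique h4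
  show ContDiffOn ℝ _ (fun t : ℝ => MvPolynomial.eval (fun i => (t • v) i) p) _ ∧ ∀ k : ℕ,
    2 ≤ k → k ≤ m → ∀ t ∈ raySet Ω v, |MvPolynomial.eval (fun i => (t • v) i) p| ^ (k - 1) *
      |iteratedDerivWithin k (fun t : ℝ => MvPolynomial.eval (fun i => (t • v) i) p) _ t| ≤ _ *
      |derivWithin (fun t : ℝ => MvPolynomial.eval (fun i => (t • v) i) p) _ t| ^ k
  rw [hfe]
  refine ⟨(by simpa using (Polynomial.contDiff_aeval (𝕜 := ℝ) P (m : ℕ∞)).contDiffOn), ?_⟩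
  intro k hk hkm t ht
  rw [hPe, aux_itd P _ hU k t ht,
    (P.hasDerivAt t).hasDerivWithinAt.derivWithin (hU t ht)]
  obtain ⟨j, rfl⟩ : ∃ j, k = j + 1 := ⟨k - 1, by omega⟩
  rw [Nat.add_sub_cancel]
  have hKj : K j ≤ ∑ k ∈ Finset.range (m + 1), K k + 1 := by
    have := Finset.single_le_sum (f := K) (s := Finset.range (m + 1)) (fun i _ => hK i)
      (Finset.mem_range.2 (by omega : j < m + 1))
    linarith
  rcases ht.1.eq_or_lt with h | h
  · subst h
    rw [hP0, abs_zero, zero_pow (by omega), zero_mul]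
    exact mul_nonneg ((hK j).trans hKj) (by positivity)
  · refine (H j P t hPd h (hmono.mono (hsc.ordConnected.out h0s ht)) hP0 hP0').trans ?_
    gcongr
end

section
/- Let f be a smooth convex function on an open convex set Ω ⊂ R^d which is finite type in the sense of Bruna, Nagel, and Wainger: for every x₀ ∈ Ω and every unit vector ω there exists a finite k ≥ 2 with Σ_{i=2}^k |(ω·∇)^i f(x₀)| ≠ 0. Then for every compact convex subset Ω' ⊂ Ω and every m ≥ 2 there is a constant C such that for all x₀ ∈ Ω', the convex function f_{x₀}(x) := f(x) − f(x₀) − (x−x₀)·∇f(x₀) is uniformly radially tame to order m with respect to the origin point x₀ with constant C; that is, for every x ∈ Ω' and every k = 2,…,m and t ∈ [0,1], the function g(t) := f_{x₀}(x₀ + t(x−x₀)) satisfies |g(t)|^{k−1} |g^{(k)}(t)| ≤ C |g'(t)|^k. -/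
open Metric Set


lemma aux_taylor (n : ℕ) : ∀ (g : ℕ → ℝ → ℝ) (M S : ℝ),
    (∀ j < n, ∀ x ∈ Icc (0:ℝ) S, HasDerivAt (g j) (g (j+1) x) x) →
    (∀ x ∈ Icc (0:ℝ) S, |g n x| ≤ M) → ∀ x ∈ Icc (0:ℝ) S,
    |g 0 x - ∑ j ∈ Finset.range n, g j 0 / (Nat.factorial j : ℝ) * x ^ j| ≤ M * x ^ n := by
  induction n with
  | zero => intro g M S _ h x hx; simpa using h x hx
  | succ n ih =>
    intro g M S hd hM x hx
    have hMnn : 0 ≤ M := le_trans (abs_nonneg _) (hM x hx)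
    have key := ih (fun j => g (j+1)) M S (fun j hj y hy => hd (j+1) (by omega) y hy) hM
    have hder : ∀ y ∈ Icc (0:ℝ) x, HasDerivWithinAt
        (fun x => g 0 x - ∑ j ∈ Finset.range (n+1), g j 0 / (Nat.factorial j : ℝ) * x ^ j)
        (g 1 y - ∑ j ∈ Finset.range n, g (j+1) 0 / (Nat.factorial j : ℝ) * y ^ j) (Icc 0 x) y := by
      intro y hy
      apply HasDerivAt.hasDerivWithinAt
      refine (hd 0 (by omega) y ⟨hy.1, hy.2.trans hx.2⟩).sub ?_
      have : HasDerivAt (fun x : ℝ => ∑ j ∈ Finset.range (n+1), g j 0 / (Nat.factorial j : ℝ) * x ^ j)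
          (∑ j ∈ Finset.range (n+1), g j 0 / (Nat.factorial j : ℝ) * (j * y ^ (j-1))) y := by
        apply HasDerivAt.fun_sum
        intro j _
        exact (hasDerivAt_pow j y).const_mul _
      refine this.congr_deriv ?_
      symm
      rw [Finset.sum_range_succ']
      simp only [Nat.factorial_succ, Nat.cast_zero, zero_mul, mul_zero, add_zero]
      refine Finset.sum_congr rfl fun j _ => ?_
      have h1 : (Nat.factorial j : ℝ) ≠ 0 := by positivity
      have h2 : ((j:ℝ) + 1) ≠ 0 := by positivity
      push_cast
      field_simp
      try simp
    have := norm_image_sub_le_of_norm_deriv_le_segment' (C := M * x ^ n) hder (by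
      intro y hy
      refine (key y ⟨hy.1, hy.2.le.trans hx.2⟩).trans ?_
      have := hy.1
      have := hy.2.le
      gcongr) x ⟨hx.1, le_rfl⟩
    have h0 : g 0 0 - ∑ j ∈ Finset.range (n+1), g j 0 / (Nat.factorial j : ℝ) * (0:ℝ) ^ j = 0 := by
      rw [Finset.sum_range_succ']; simp
    rw [h0, sub_zero, sub_zero, Real.norm_eq_abs] at this
    rw [pow_succ, ← mul_assoc]; exact this

lemma aux_poly (N : ℕ) : ∃ K : ℝ, 0 < K ∧ ∀ (a : ℕ → ℝ) (B : ℝ),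
    (∀ u ∈ Icc (0:ℝ) 1, |∑ j ∈ Finset.range (N+1), a j * u ^ j| ≤ B) →
    ∀ j ≤ N, |a j| ≤ K * B := by
  let v : Fin (N+1) → ℝ := fun i => (i:ℝ) / (N+1)
  have hv : Function.Injective v := by
    intro i j hij
    have h2 : ((N:ℝ) + 1) ≠ 0 := by positivity
    simp only [v] at hij
    field_simp at hij
    exact Fin.ext (by exact_mod_cast hij)
  let T : (Fin (N+1) → ℝ) →ₗ[ℝ] (Fin (N+1) → ℝ) := Matrix.mulVecLin (Matrix.vandermonde v)
  have hT : LinearMap.ker T = ⊥ := by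
    rw [LinearMap.ker_eq_bot, Matrix.coe_mulVecLin]
    apply Matrix.mulVec_injective_of_isUnit
    rw [Matrix.isUnit_iff_isUnit_det, isUnit_iff_ne_zero]
    exact Matrix.det_vandermonde_ne_zero_iff.2 hv
  obtain ⟨K, hK, hKT⟩ := LinearMap.exists_antilipschitzWith T hT
  refine ⟨K, by exact_mod_cast hK, fun a B hB j hj => ?_⟩
  have hBnn : 0 ≤ B := (abs_nonneg _).trans (hB 0 (by simp))
  have h1 := hKT.le_mul_dist (fun i : Fin (N+1) => a i) 0
  rw [map_zero, dist_zero_right, dist_zero_right] at h1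
  have h2 : ‖T (fun i : Fin (N+1) => a i)‖ ≤ B := by
    rw [pi_norm_le_iff_of_nonneg hBnn]
    intro i
    have := hB (v i) ⟨by positivity, by
      simp only [v]
      rw [div_le_one (by positivity)]
      have := i.2
      exact_mod_cast this.le⟩
    rw [Finset.sum_range] at this
    rw [Real.norm_eq_abs]
    convert this using 2
    simp only [T, Matrix.mulVecLin_apply, Matrix.mulVec, dotProduct, Matrix.vandermonde_apply]
    exact Finset.sum_congr rfl fun _ _ => mul_comm _ _
  have h3 := norm_le_pi_norm (fun i : Fin (N+1) => a i) ⟨j, by omega⟩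
  simp only [Real.norm_eq_abs] at h3
  exact h3.trans (h1.trans (by gcongr))

lemma aux_1d (N : ℕ) (M c : ℝ) (hM : 0 ≤ M) (hc : 0 < c) : ∃ δ C : ℝ, 0 < δ ∧ 0 < C ∧
    ∀ (s : ℝ) (h : ℕ → ℝ → ℝ), 0 ≤ s → s ≤ δ →
    (∀ j ≤ N, ∀ x ∈ Icc (0:ℝ) s, HasDerivAt (h j) (h (j+1) x) x) →
    (∀ x ∈ Icc (0:ℝ) s, |h (N+1) x| ≤ M) → c ≤ |h N s| →
    (∀ x ∈ Icc (0:ℝ) s, 0 ≤ h 0 x ∧ h 0 x ≤ h 0 s) →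
    s ^ N ≤ C * h 0 s ∧ ∀ j ≤ N, s ^ j * |h j s| ≤ C * h 0 s := by
  obtain ⟨K, hK, hpoly⟩ := aux_poly N
  set F : ℝ := (Nat.factorial N : ℝ) * K with hF
  have hFpos : 0 < F := by positivity
  refine ⟨c / (2 * F * (M + 1)), F + F * M * (c / (2 * F * (M + 1))) * (2 * F / c) + 2 * F / c,
    by positivity, by positivity, ?_⟩
  set δ := c / (2 * F * (M + 1)) with hδ
  have hδpos : 0 < δ := by positivity
  intro s h hs hsδ hd hMb hcb hmon
  have hA : 0 ≤ h 0 s := (hmon s ⟨hs, le_rfl⟩).1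
  set A := h 0 s with hAdef
  have ht := aux_taylor (N+1) (fun j x => (-1)^j * h j (s - x)) M s (by
    intro j hj x hx
    have h1 := (hd j (by omega) (s - x) ⟨by linarith [hx.2], by linarith [hx.1]⟩).comp x
      ((hasDerivAt_id x).const_sub s)
    have h2 := h1.const_mul ((-1:ℝ)^j)
    refine h2.congr_deriv ?_
    ring) (by
    intro x hx
    have := hMb (s-x) ⟨by linarith [hx.2], by linarith [hx.1]⟩
    simpa [abs_mul] using this)
  have hco := hpoly (fun j => (-1)^j * h j s / (Nat.factorial j : ℝ) * s ^ j) (A + M * s ^ (N+1)) (by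
    intro u hu
    have hsu : s * u ∈ Icc (0:ℝ) s := ⟨mul_nonneg hs hu.1, by nlinarith [hu.2]⟩
    have h1 := ht (s * u) hsu
    have h2 := hmon (s - s*u) ⟨by linarith [hsu.2], by linarith [hsu.1]⟩
    have h3 : M * (s * u)^(N+1) ≤ M * s ^(N+1) := by
      have := hsu.2; have := hsu.1
      gcongr
    simp only [pow_zero, one_mul, sub_zero] at h1
    have h4 : ∑ j ∈ Finset.range (N+1), (-1)^j * h j s / (Nat.factorial j : ℝ) * s ^ j * u ^ j
      = ∑ j ∈ Finset.range (N+1), (-1)^j * h j s / (Nat.factorial j : ℝ) * (s * u) ^ j :=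
      Finset.sum_congr rfl fun j _ => by rw [mul_pow]; ring
    rw [h4]
    rw [abs_le] at h1 ⊢
    constructor <;> linarith [h1.1, h1.2, h2.1, h2.2])
  have hj : ∀ j ≤ N, s ^ j * |h j s| ≤ F * (A + M * s ^ (N+1)) := by
    intro j hjN
    have h1 := hco j hjN
    have hfp : (0:ℝ) < Nat.factorial j := by positivity
    have h2 : |(-1)^j * h j s / (Nat.factorial j : ℝ) * s ^ j| = s ^ j * |h j s| / Nat.factorial j := by
      rw [abs_mul, abs_div, abs_mul, abs_pow, abs_pow, abs_neg, abs_one, one_pow, abs_of_nonneg hs,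
        abs_of_pos hfp]
      ring
    rw [h2, div_le_iff₀ hfp] at h1
    refine h1.trans ?_
    have h5 : (Nat.factorial j : ℝ) ≤ Nat.factorial N := by exact_mod_cast Nat.factorial_le hjN
    have h6 : 0 ≤ A + M * s ^ (N+1) := by positivity
    calc K * (A + M * s ^ (N+1)) * Nat.factorial j ≤ K * (A + M * s ^ (N+1)) * Nat.factorial N := by gcongr
      _ = _ := by rw [hF]; ring
  have hsN : 0 ≤ s ^ N := by positivity
  have hmain : s ^ N ≤ 2 * F / c * A := by
    have h1 := hj N le_rfl
    have h2 : s ^ N * c ≤ s ^ N * |h N s| := by gcongr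
    have h3 : F * M * s ≤ c / 2 := by
      calc F * M * s ≤ F * (M+1) * δ := by gcongr; linarith
        _ = c / 2 := by rw [hδ]; field_simp
    have h4 : F * M * s * s ^ N ≤ c / 2 * s ^ N := by gcongr
    have h5 : s ^ N * c ≤ 2 * F * A := by
      rw [pow_succ] at h1; nlinarith
    rw [div_mul_eq_mul_div, le_div_iff₀ hc]; exact h5
  have e1 : 0 ≤ F * A := by positivity
  have e2 : 0 ≤ F * M * δ * (2 * F / c) * A := by positivity
  have e3 : 0 ≤ 2 * F / c * A := by positivity
  constructor
  · linarith
  · intro j hjN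
    have h1 := hj j hjN
    have h2 : F * M * s * s ^ N ≤ F * M * δ * (2 * F / c * A) := by gcongr
    rw [pow_succ] at h1
    linarith

section
variable {E : Type*} [NormedAddCommGroup E] [NormedSpace ℝ E]

/-- Iterated directional derivative. -/
noncomputable def DD (f : E → ℝ) (Ω : Set E) (j : ℕ) (p w : E) : ℝ :=
  iteratedFDerivWithin ℝ j f Ω p (fun _ => w)

lemma DD_one {f : E → ℝ} {Ω : Set E} (hΩ : IsOpen Ω) {p : E} (hp : p ∈ Ω) (w : E) :
    DD f Ω 1 p w = fderivWithin ℝ f Ω p w := by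
  unfold DD
  rw [iteratedFDerivWithin_one_apply (hΩ.uniqueDiffWithinAt hp)]

lemma DD_smul {f : E → ℝ} {Ω : Set E} (j : ℕ) (p w : E) (L : ℝ) :
    DD f Ω j p (L • w) = L ^ j * DD f Ω j p w := by
  unfold DD
  have := (iteratedFDerivWithin ℝ j f Ω p).map_smul_univ (fun _ => L) (fun _ => w)
  simpa using this

lemma DD_cont {f : E → ℝ} {Ω : Set E} (hΩ : IsOpen Ω) (hf : ContDiffOn ℝ (⊤ : ℕ∞) f Ω) (j : ℕ)
    {q : E × E} (hq : q.1 ∈ Ω) : ContinuousAt (fun q : E × E => DD f Ω j q.1 q.2) q := by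
  unfold DD
  have h1 : ContinuousAt (iteratedFDerivWithin ℝ j f Ω) q.1 :=
    (hf.continuousOn_iteratedFDerivWithin (by exact_mod_cast le_top) hΩ.uniqueDiffOn).continuousAt
      (hΩ.mem_nhds hq)
  have h2 : ContinuousAt (fun q : E × E => iteratedFDerivWithin ℝ j f Ω q.1) q :=
    ContinuousAt.comp (f := Prod.fst) h1 continuousAt_fst
  exact h2.eval (by fun_prop)

lemma DD_deriv {f : E → ℝ} {Ω : Set E} (hΩ : IsOpen Ω) (hf : ContDiffOn ℝ (⊤ : ℕ∞) f Ω) (j : ℕ)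
    {y w : E} {s : ℝ} (hq : y + s • w ∈ Ω) :
    HasDerivAt (fun u : ℝ => DD f Ω j (y + u • w) w) (DD f Ω (j+1) (y + s • w) w) s := by
  unfold DD
  have h1 : DifferentiableAt ℝ (iteratedFDerivWithin ℝ j f Ω) (y + s • w) :=
    (hf.differentiableOn_iteratedFDerivWithin (by exact_mod_cast ENat.natCast_lt_top j)
      hΩ.uniqueDiffOn).differentiableAt (hΩ.mem_nhds hq)
  have h2 : HasDerivAt (fun u : ℝ => y + u • w) w s := by
    simpa using ((hasDerivAt_id s).smul_const w).const_add y
  have h3 := h1.hasFDerivAt.comp_hasDerivAt s h2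
  have h4 := (ContinuousMultilinearMap.apply ℝ (fun _ : Fin j => E) ℝ
    (fun _ => w)).hasFDerivAt.comp_hasDerivAt s h3
  rw [iteratedFDerivWithin_succ_apply_left, fderivWithin_of_isOpen hΩ hq]
  exact h4

lemma DD_slope {f : E → ℝ} {Ω : Set E} (hΩ : IsOpen Ω) (hf : ContDiffOn ℝ (⊤ : ℕ∞) f Ω)
    (hc : ConvexOn ℝ Ω f) {y w : E} {a b : ℝ} (ha : y + a • w ∈ Ω) (hb : y + b • w ∈ Ω)
    (hab : a ≤ b) :
    (b - a) * DD f Ω 1 (y + a • w) w ≤ f (y + b • w) - f (y + a • w) ∧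
    f (y + b • w) - f (y + a • w) ≤ (b - a) * DD f Ω 1 (y + b • w) w ∧
    DD f Ω 1 (y + a • w) w ≤ DD f Ω 1 (y + b • w) w := by
  rcases hab.eq_or_lt with rfl | hlt
  · simp
  have hcv : ConvexOn ℝ ((AffineMap.lineMap y (y + w) : ℝ →ᵃ[ℝ] E) ⁻¹' Ω)
      (f ∘ (AffineMap.lineMap y (y + w) : ℝ →ᵃ[ℝ] E)) := hc.comp_affineMap _
  have he : ∀ u : ℝ, (AffineMap.lineMap y (y + w) : ℝ →ᵃ[ℝ] E) u = y + u • w := by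
    intro u; simp [AffineMap.lineMap_apply, add_comm]
  have hfun : (f ∘ (AffineMap.lineMap y (y + w) : ℝ →ᵃ[ℝ] E)) = fun u : ℝ => DD f Ω 0 (y + u • w) w := by
    funext u; simp [DD, he]
  rw [hfun] at hcv
  have h1 := hcv.le_slope_of_hasDerivAt (by simpa [he] using ha) (by simpa [he] using hb) hlt
    (DD_deriv hΩ hf 0 ha)
  have h2 := hcv.slope_le_of_hasDerivAt (by simpa [he] using ha) (by simpa [he] using hb) hlt
    (DD_deriv hΩ hf 0 hb)
  have h3 := h1.trans h2
  have hba : 0 < b - a := by linarith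
  rw [slope_def_field, le_div_iff₀ hba] at h1
  rw [slope_def_field, div_le_iff₀ hba] at h2
  simp only [DD, iteratedFDerivWithin_zero_apply] at h1 h2 h3 ⊢
  refine ⟨by linarith, by linarith, h3⟩

lemma aux_local {f : E → ℝ} {Ω : Set E} (hΩ : IsOpen Ω) (hf : ContDiffOn ℝ (⊤ : ℕ∞) f Ω)
    (hc : ConvexOn ℝ Ω f) {x₀ v : E} (hx : x₀ ∈ Ω) (hv : ‖v‖ = 1)
    {N : ℕ} (hN : DD f Ω (N+1) x₀ v ≠ 0) (hN1 : 1 ≤ N) (m : ℕ) :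
    ∃ r C : ℝ, 0 < r ∧ 0 < C ∧ ∀ y ∈ ball x₀ r, ∀ w ∈ ball v r, ∀ s : ℝ, 0 ≤ s → s < r →
      s ^ N ≤ C * (DD f Ω 1 (y + s • w) w - DD f Ω 1 y w) ∧ ∀ j, 1 ≤ j → j ≤ m →
        s ^ j * |DD f Ω (j+1) (y + s • w) w| ≤ C * (DD f Ω 1 (y + s • w) w - DD f Ω 1 y w) := by
  set c := |DD f Ω (N+1) x₀ v| / 2 with hcdef
  have hcpos : 0 < c := by have := abs_pos.2 hN; positivity
  set M := ∑ j ∈ Finset.range (m + N + 3), |DD f Ω j x₀ v| + 1 with hM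
  have hMpos : 0 < M := by positivity
  have ev : ∀ᶠ q : E × E in nhds (x₀, v), q.1 ∈ Ω ∧ c < |DD f Ω (N+1) q.1 q.2| ∧
      ∑ j ∈ Finset.range (m + N + 3), |DD f Ω j q.1 q.2| < M := by
    refine Filter.Eventually.and ?_ (Filter.Eventually.and ?_ ?_)
    · exact continuousAt_fst.eventually (hΩ.mem_nhds hx)
    · have : ContinuousAt (fun q : E × E => |DD f Ω (N+1) q.1 q.2|) (x₀, v) :=
        (DD_cont hΩ hf _ hx).abs
      exact this.eventually (lt_mem_nhds (by simp only; linarith))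
    · have : ContinuousAt (fun q : E × E => ∑ j ∈ Finset.range (m + N + 3), |DD f Ω j q.1 q.2|)
          (x₀, v) := tendsto_finsetSum _ fun j _ => (DD_cont hΩ hf j (q := (x₀, v)) hx).abs
      exact this.eventually (gt_mem_nhds (by simp only; linarith))
  obtain ⟨ρ, hρ, hball⟩ := Metric.eventually_nhds_iff.1 ev
  obtain ⟨δ, C, hδ, hC, h1d⟩ := aux_1d N M c hMpos.le hcpos
  refine ⟨min δ (min 1 (ρ/4)), C + M * C, by positivity, by positivity, ?_⟩
  intro y hy w hw s hs hsr
  have hsδ : s ≤ δ := hsr.le.trans (min_le_left _ _)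
  have hs1 : s ≤ 1 := hsr.le.trans ((min_le_right _ _).trans (min_le_left _ _))
  have hsρ : s ≤ ρ/4 := hsr.le.trans ((min_le_right _ _).trans (min_le_right _ _))
  have hyρ : dist y x₀ < ρ/4 := lt_of_lt_of_le (mem_ball.1 hy) ((min_le_right _ _).trans (min_le_right _ _))
  have hwρ : dist w v < ρ/4 := lt_of_lt_of_le (mem_ball.1 hw) ((min_le_right _ _).trans (min_le_right _ _))
  have hw1 : dist w v < 1 := lt_of_lt_of_le (mem_ball.1 hw) ((min_le_right _ _).trans (min_le_left _ _))
  have hwn : ‖w‖ ≤ 2 := by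
    have := norm_le_norm_add_norm_sub' w v
    rw [← dist_eq_norm] at this
    linarith
  have hin : ∀ u ∈ Icc (0:ℝ) s, (y + u • w) ∈ Ω ∧ c < |DD f Ω (N+1) (y + u • w) w| ∧
      ∑ j ∈ Finset.range (m + N + 3), |DD f Ω j (y + u • w) w| < M := by
    intro u hu
    refine hball (y := (y + u • w, w)) ?_
    rw [Prod.dist_eq, max_lt_iff]
    refine ⟨?_, by simp only; linarith⟩
    have h1 : dist (y + u • w) x₀ ≤ dist (y + u • w) y + dist y x₀ := dist_triangle _ _ _
    have h2 : dist (y + u • w) y = u * ‖w‖ := by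
      rw [dist_eq_norm, add_sub_cancel_left, norm_smul, Real.norm_eq_abs, abs_of_nonneg hu.1]
    have h3 : u * ‖w‖ ≤ ρ/4 * 2 := by
      have := hu.2.trans hsρ
      gcongr
    simp only
    linarith
  have hbd : ∀ u ∈ Icc (0:ℝ) s, ∀ j < m + N + 3, |DD f Ω j (y + u • w) w| ≤ M := by
    intro u hu j hj
    refine le_trans ?_ (hin u hu).2.2.le
    exact Finset.single_le_sum (f := fun j => |DD f Ω j (y + u • w) w|)
      (fun _ _ => abs_nonneg _) (Finset.mem_range.2 hj)
  have h0s : (0:ℝ) ∈ Icc (0:ℝ) s := ⟨le_rfl, hs⟩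
  have hss : s ∈ Icc (0:ℝ) s := ⟨hs, le_rfl⟩
  have hN0 : N ≠ 0 := by omega
  have res := h1d s (fun j u => DD f Ω (j+1) (y + u • w) w - if j = 0 then DD f Ω 1 y w else 0) hs hsδ
    (by
      intro j _ x hx
      have := (DD_deriv hΩ hf (j+1) (hin x hx).1).sub_const (if j = 0 then DD f Ω 1 y w else 0)
      simpa using this)
    (by
      intro x hx
      simpa using hbd x hx (N+1+1) (by omega))
    (by
      simpa [hN0] using (hin s hss).2.1.le)
    (by
      intro x hx
      have a1 := (DD_slope hΩ hf hc (hin 0 h0s).1 (hin x hx).1 hx.1).2.2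
      have a2 := (DD_slope hΩ hf hc (hin x hx).1 (hin s hss).1 hx.2).2.2
      simp only [zero_smul, add_zero] at a1
      simp only [zero_add, if_true]
      constructor <;> linarith)
  simp only [zero_add, if_true] at res
  obtain ⟨r1, r2⟩ := res
  have hh : 0 ≤ C * (DD f Ω 1 (y + s • w) w - DD f Ω 1 y w) := le_trans (by positivity) r1
  have hMh : 0 ≤ M * (C * (DD f Ω 1 (y + s • w) w - DD f Ω 1 y w)) := by positivity
  refine ⟨by linarith, fun j hj1 hjm => ?_⟩
  by_cases hjN : j ≤ N
  · have := r2 j hjN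
    have hj0 : j ≠ 0 := by omega
    simp only [hj0, if_false, sub_zero] at this
    linarith
  · have b1 := hbd s hss (j+1) (by omega)
    have b2 : s ^ j ≤ s ^ N := pow_le_pow_of_le_one hs hs1 (by omega)
    calc s ^ j * |DD f Ω (j+1) (y + s • w) w| ≤ s ^ N * M := by gcongr
      _ ≤ (C * (DD f Ω 1 (y + s • w) w - DD f Ω 1 y w)) * M := by gcongr
      _ ≤ _ := by linarith
end

lemma aux_global (d : ℕ) (Ω : Set (EuclideanSpace ℝ (Fin d)))
    (f : EuclideanSpace ℝ (Fin d) → ℝ)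
    (hΩ : IsOpen Ω) (hΩconv : Convex ℝ Ω)
    (hf : ContDiffOn ℝ (⊤ : ℕ∞) f Ω) (hfconv : ConvexOn ℝ Ω f)
    (hft : ∀ x₀ ∈ Ω, ∀ v : EuclideanSpace ℝ (Fin d), ‖v‖ = 1 →
      ∃ N : ℕ, 1 ≤ N ∧ DD f Ω (N+1) x₀ v ≠ 0)
    (Ω' : Set (EuclideanSpace ℝ (Fin d))) (hK : IsCompact Ω') (hsub : Ω' ⊆ Ω) (m : ℕ) :
    ∃ C : ℝ, 0 < C ∧ ∀ x ∈ Ω', ∀ v : EuclideanSpace ℝ (Fin d), ‖v‖ = 1 → ∀ s : ℝ, 0 ≤ s →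
      x + s • v ∈ Ω' → ∀ j, 1 ≤ j → j ≤ m →
        s ^ j * |DD f Ω (j+1) (x + s • v) v| ≤ C * (DD f Ω 1 (x + s • v) v - DD f Ω 1 x v) := by
  let EE := EuclideanSpace ℝ (Fin d)
  let pr : Set (EE × EE × ℝ) := Ω' ×ˢ (sphere (0 : EE) 1 ×ˢ Icc (0:ℝ) (diam Ω'))
  let mv : EE × EE × ℝ → EE := fun q => q.1 + q.2.2 • q.2.1
  have hmv : Continuous mv := by fun_prop
  have hcomp : IsCompact (pr ∩ mv ⁻¹' Ω') :=
    (hK.prod ((isCompact_sphere _ _).prod isCompact_Icc)).inter_right (hK.isClosed.preimage hmv)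
  have hnn : ∀ q ∈ pr ∩ mv ⁻¹' Ω', 0 ≤ DD f Ω 1 (mv q) q.2.1 - DD f Ω 1 q.1 q.2.1 := by
    intro q hq
    have := (DD_slope hΩ hf hfconv (y := q.1) (w := q.2.1) (a := 0) (b := q.2.2)
      (by simpa using hsub hq.1.1) (hsub hq.2) hq.1.2.2.1).2.2
    simp only [zero_smul, add_zero] at this
    simp only [mv]
    linarith
  have main : ∃ C : ℝ, 0 < C ∧ ∀ q ∈ pr ∩ mv ⁻¹' Ω', q ∈ pr ∩ mv ⁻¹' Ω' → ∀ j, 1 ≤ j → j ≤ m →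
      q.2.2 ^ j * |DD f Ω (j+1) (mv q) q.2.1| ≤ C * (DD f Ω 1 (mv q) q.2.1 - DD f Ω 1 q.1 q.2.1) := by
    refine hcomp.induction_on (p := fun S => ∃ C : ℝ, 0 < C ∧ ∀ q ∈ S, q ∈ pr ∩ mv ⁻¹' Ω' →
      ∀ j, 1 ≤ j → j ≤ m →
      q.2.2 ^ j * |DD f Ω (j+1) (mv q) q.2.1| ≤ C * (DD f Ω 1 (mv q) q.2.1 - DD f Ω 1 q.1 q.2.1))
      ⟨1, one_pos, by simp⟩ ?_ ?_ ?_
    · rintro S T hST ⟨C, hC, h⟩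
      exact ⟨C, hC, fun q hq => h q (hST hq)⟩
    · rintro S T ⟨C, hC, h⟩ ⟨C', hC', h'⟩
      refine ⟨C + C', by positivity, ?_⟩
      intro q hq hqK j hj1 hjm
      have h0 := hnn q hqK
      have e1 := mul_nonneg hC.le h0
      have e2 := mul_nonneg hC'.le h0
      rw [add_mul]
      rcases hq with hq | hq
      · linarith [h q hq hqK j hj1 hjm]
      · linarith [h' q hq hqK j hj1 hjm]
    · intro q hq
      have hx : q.1 ∈ Ω := hsub hq.1.1
      have hv : ‖q.2.1‖ = 1 := by simpa using hq.1.2.1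
      have hs : 0 ≤ q.2.2 := hq.1.2.2.1
      have hz : mv q ∈ Ω := hsub hq.2
      obtain ⟨N, hN1, hN⟩ := hft q.1 hx q.2.1 hv
      obtain ⟨r, C, hr, hC, hloc⟩ := aux_local hΩ hf hfconv hx hv hN hN1 m
      rcases hs.eq_or_lt with hs0 | hspos
      · refine ⟨ball q.1 r ×ˢ (ball q.2.1 r ×ˢ ball q.2.2 r), mem_nhdsWithin_of_mem_nhds ?_,
          C, hC, ?_⟩
        · exact prod_mem_nhds (ball_mem_nhds _ hr)
            (prod_mem_nhds (ball_mem_nhds _ hr) (ball_mem_nhds _ hr))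
        · intro q' hq' hqK'
          refine (hloc q'.1 hq'.1 q'.2.1 hq'.2.1 q'.2.2 hqK'.1.2.2.1 ?_).2
          have := hq'.2.2
          rw [← hs0, mem_ball, Real.dist_eq, sub_zero] at this
          exact (le_abs_self _).trans_lt this
      · -- positivity
        have hpos : 0 < DD f Ω 1 (mv q) q.2.1 - DD f Ω 1 q.1 q.2.1 := by
          let s' := min (r/2) q.2.2
          have hs' : 0 < s' := by positivity
          have hs'r : s' < r := (min_le_left _ _).trans_lt (by linarith)
          have h1 := (hloc q.1 (mem_ball_self hr) q.2.1 (mem_ball_self hr) s' hs'.le hs'r).1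
          have h2 : 0 < DD f Ω 1 (q.1 + s' • q.2.1) q.2.1 - DD f Ω 1 q.1 q.2.1 := by
            have : 0 < C * (DD f Ω 1 (q.1 + s' • q.2.1) q.2.1 - DD f Ω 1 q.1 q.2.1) :=
              lt_of_lt_of_le (by positivity) h1
            exact pos_of_mul_pos_right this hC.le
          have hmem : q.1 + s' • q.2.1 ∈ Ω := by
            have h3 := hΩconv.add_smul_sub_mem hx hz (t := s' / q.2.2)
              ⟨by positivity, by rw [div_le_one hspos]; exact min_le_right _ _⟩
            have h4 : (s' / q.2.2) • (mv q - q.1) = s' • q.2.1 := by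
              simp only [mv, add_sub_cancel_left, smul_smul]
              rw [div_mul_cancel₀ _ hspos.ne']
            rwa [h4] at h3
          have h3 := (DD_slope hΩ hf hfconv hmem hz (min_le_right _ _)).2.2
          simp only [mv]
          linarith
        set H := DD f Ω 1 (mv q) q.2.1 - DD f Ω 1 q.1 q.2.1 with hH
        set Sg := ∑ j ∈ Finset.range (m+1), q.2.2 ^ j * |DD f Ω (j+1) (mv q) q.2.1| with hSg
        have hSnn : 0 ≤ Sg := Finset.sum_nonneg fun j _ => by positivity
        have cD : ∀ j, ContinuousAt (fun q : EE × EE × ℝ => DD f Ω j (mv q) q.2.1) q := by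
          intro j
          exact ContinuousAt.comp (f := fun q : EE × EE × ℝ => (mv q, q.2.1))
            (DD_cont hΩ hf j (q := (mv q, q.2.1)) hz) (by fun_prop)
        have cD1 : ContinuousAt (fun q : EE × EE × ℝ => DD f Ω 1 q.1 q.2.1) q :=
          ContinuousAt.comp (f := fun q : EE × EE × ℝ => (q.1, q.2.1))
            (DD_cont hΩ hf 1 (q := (q.1, q.2.1)) hx) (by fun_prop)
        have c1 : ContinuousAt (fun q : EE × EE × ℝ =>
            ∑ j ∈ Finset.range (m+1), q.2.2 ^ j * |DD f Ω (j+1) (mv q) q.2.1|) q :=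
          tendsto_finsetSum _ fun j _ => ContinuousAt.mul (by fun_prop) (cD (j+1)).abs
        have c2 : ContinuousAt (fun q : EE × EE × ℝ =>
            (Sg + 1) / H * (DD f Ω 1 (mv q) q.2.1 - DD f Ω 1 q.1 q.2.1)) q :=
          ((cD 1).sub cD1).const_mul _
        have ev := c1.eventually_lt c2 (by
          rw [← hH, div_mul_cancel₀ _ hpos.ne']
          linarith)
        refine ⟨_, mem_nhdsWithin_of_mem_nhds ev, (Sg + 1) / H, by positivity, ?_⟩
        intro q' hq' hqK' j hj1 hjm
        refine le_trans ?_ (le_of_lt hq')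
        have hs' : 0 ≤ q'.2.2 := hqK'.1.2.2.1
        exact Finset.single_le_sum (f := fun j => q'.2.2 ^ j * |DD f Ω (j+1) (mv q') q'.2.1|)
          (fun j _ => by positivity) (Finset.mem_range.2 (by omega))
  obtain ⟨C, hC, h⟩ := main
  refine ⟨C, hC, fun x hx v hv s hs hxs => ?_⟩
  have hmem : (x, v, s) ∈ pr ∩ mv ⁻¹' Ω' := by
    refine ⟨⟨hx, by simpa using hv, hs, ?_⟩, hxs⟩
    have := dist_le_diam_of_mem hK.isBounded hxs hx
    rwa [dist_eq_norm, add_sub_cancel_left, norm_smul, hv, mul_one, Real.norm_eq_abs,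
      abs_of_nonneg hs] at this
  exact h _ hmem hmem

theorem statement_4 (d : ℕ) (Ω : Set (EuclideanSpace ℝ (Fin d)))
    (f : EuclideanSpace ℝ (Fin d) → ℝ)
    (hΩ : IsOpen Ω) (hΩconv : Convex ℝ Ω)
    (hf : ContDiffOn ℝ (⊤ : ℕ∞) f Ω) (hfconv : ConvexOn ℝ Ω f)
    (hft : ∀ x₀ ∈ Ω, ∀ v : EuclideanSpace ℝ (Fin d), ‖v‖ = 1 →
      ∃ k : ℕ, 2 ≤ k ∧
        (∑ i ∈ Finset.Icc 2 k,
          |iteratedFDerivWithin ℝ i f Ω x₀ (fun _ => v)|) ≠ 0) :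
    ∀ Ω' : Set (EuclideanSpace ℝ (Fin d)),
      IsCompact Ω' → Convex ℝ Ω' → Ω' ⊆ Ω →
      ∀ m : ℕ, 2 ≤ m →
        ∃ C : ℝ, 0 < C ∧
          ∀ x₀ ∈ Ω', ∀ x ∈ Ω', ∀ k : ℕ, 2 ≤ k → k ≤ m →
            ∀ t ∈ Icc (0 : ℝ) 1,
              |f (x₀ + t • (x - x₀)) - f x₀ -
                  t * fderivWithin ℝ f Ω x₀ (x - x₀)| ^ (k - 1) *
                |iteratedFDerivWithin ℝ k f Ω (x₀ + t • (x - x₀))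
                  (fun _ => x - x₀)| ≤
              C * |fderivWithin ℝ f Ω (x₀ + t • (x - x₀)) (x - x₀) -
                    fderivWithin ℝ f Ω x₀ (x - x₀)| ^ k := by
  intro Ω' hK hKc hsub m hm
  have hft' : ∀ x₀ ∈ Ω, ∀ v : EuclideanSpace ℝ (Fin d), ‖v‖ = 1 →
      ∃ N : ℕ, 1 ≤ N ∧ DD f Ω (N+1) x₀ v ≠ 0 := by
    intro x₀ hx v hv
    obtain ⟨k, _, hk⟩ := hft x₀ hx v hv
    obtain ⟨i, hi, hi0⟩ := Finset.exists_ne_zero_of_sum_ne_zero hk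
    rw [Finset.mem_Icc] at hi
    obtain ⟨N, rfl⟩ : ∃ N, i = N + 1 := ⟨i - 1, by omega⟩
    exact ⟨N, by omega, abs_ne_zero.1 hi0⟩
  obtain ⟨C, hC, h⟩ := aux_global d Ω f hΩ hΩconv hf hfconv hft' Ω' hK hsub m
  refine ⟨C, hC, ?_⟩
  intro x₀ hx₀ x hx k hk2 hkm t ht
  have hzm : x₀ + t • (x - x₀) ∈ Ω' := hKc.add_smul_sub_mem hx₀ hx ht
  rw [← DD_one hΩ (hsub hx₀), ← DD_one hΩ (hsub hzm)]
  change _ * |DD f Ω k (x₀ + t • (x - x₀)) (x - x₀)| ≤ _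
  obtain ⟨j, rfl⟩ : ∃ j, k = j + 1 := ⟨k - 1, by omega⟩
  rw [Nat.add_sub_cancel]
  by_cases hxx : x - x₀ = 0
  · have : DD f Ω (j+1) (x₀ + t • (x - x₀)) (x - x₀) = 0 := by
      rw [hxx, show (0 : EuclideanSpace ℝ (Fin d)) = (0:ℝ) • 0 by simp, DD_smul]
      simp
    rw [this, abs_zero, mul_zero]
    positivity
  set L := ‖x - x₀‖ with hL
  have hLpos : 0 < L := norm_pos_iff.2 hxx
  obtain ⟨v, hv⟩ : ∃ v, v = L⁻¹ • (x - x₀) := ⟨_, rfl⟩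
  have hvn : ‖v‖ = 1 := by
    rw [hv, norm_smul, norm_inv, Real.norm_eq_abs, abs_of_pos hLpos, ← hL, inv_mul_cancel₀ hLpos.ne']
  have hxv : x - x₀ = L • v := by
    rw [hv, smul_smul, mul_inv_cancel₀ hLpos.ne', one_smul]
  obtain ⟨s, hs⟩ : ∃ s, s = t * L := ⟨_, rfl⟩
  have hs0 : 0 ≤ s := by rw [hs]; exact mul_nonneg ht.1 hLpos.le
  have htv : t • (x - x₀) = s • v := by rw [hxv, smul_smul, hs]
  rw [htv] at hzm ⊢
  rw [hxv, DD_smul, DD_smul, DD_smul]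
  have key := h x₀ hx₀ v hvn s hs0 hzm j (by omega) (by omega)
  have sl := DD_slope hΩ hf hfconv (y := x₀) (w := v) (a := 0) (b := s)
    (by simpa using hsub hx₀) (hsub hzm) hs0
  simp only [zero_smul, add_zero, sub_zero, pow_one] at sl ⊢
  obtain ⟨s1, s2, s3⟩ := sl
  set z := x₀ + s • v with hz
  have hts : t * (L * DD f Ω 1 x₀ v) = s * DD f Ω 1 x₀ v := by rw [hs]; ring
  rw [hts]
  set H := DD f Ω 1 z v - DD f Ω 1 x₀ v with hH
  have hHnn : 0 ≤ H := by linarith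
  have e1 : L * DD f Ω 1 z v - L * DD f Ω 1 x₀ v = L * H := by rw [hH]; ring
  rw [e1, abs_of_nonneg (show 0 ≤ f z - f x₀ - s * DD f Ω 1 x₀ v by linarith),
    abs_of_nonneg (mul_nonneg hLpos.le hHnn), abs_mul, abs_of_nonneg (pow_nonneg hLpos.le _)]
  have e2 : f z - f x₀ - s * DD f Ω 1 x₀ v ≤ s * H := by rw [hH]; linarith
  have e3 : 0 ≤ f z - f x₀ - s * DD f Ω 1 x₀ v := by linarith
  calc (f z - f x₀ - s * DD f Ω 1 x₀ v) ^ j * (L ^ (j+1) * |DD f Ω (j+1) z v|)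
      ≤ (s * H) ^ j * (L ^ (j+1) * |DD f Ω (j+1) z v|) := by gcongr
    _ = H ^ j * L ^ (j+1) * (s ^ j * |DD f Ω (j+1) z v|) := by rw [mul_pow]; ring
    _ ≤ H ^ j * L ^ (j+1) * (C * H) := by gcongr
    _ = C * (L * H) ^ (j+1) := by rw [mul_pow]; ring
end

section
/- Let f be a convex function on an open convex set Ω ⊂ R^d containing the origin with f(0) = 0 and ∇f(0) = 0 (so f is nonnegative on Ω). Then for every λ > 0 and every nonnegative integer ℓ, ∫_Ω (f(x))^ℓ / (1 + λ f(x))^{d+ℓ+1} dx ≤ C λ^{−ℓ} · Leb{ x ∈ Ω : f(x) < λ^{−1} }, where C depends only on d and ℓ and Leb denotes Lebesgue measure. -/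
open Metric Set MeasureTheory
open scoped ENNReal

open scoped Pointwise

theorem s5_scale {E : Type*} [NormedAddCommGroup E] [NormedSpace ℝ E] {Ω : Set E} {f : E → ℝ}
    (h0 : (0 : E) ∈ Ω) (hf : ConvexOn ℝ Ω f) (hf0 : f 0 = 0) {x : E} (hx : x ∈ Ω)
    {t : ℝ} (ht : 0 ≤ t) (ht1 : t ≤ 1) : t • x ∈ Ω ∧ f (t • x) ≤ t * f x := by
  have h1 := hf.1 hx h0 ht (sub_nonneg.2 ht1) (by ring)
  have h2 := hf.2 hx h0 ht (sub_nonneg.2 ht1) (by ring)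
  simp only [smul_zero, add_zero, hf0, smul_eq_mul, mul_zero] at h1 h2
  exact ⟨h1, h2⟩

theorem s5_nonneg {E : Type*} [NormedAddCommGroup E] [NormedSpace ℝ E] {Ω : Set E} {f : E → ℝ}
    (h0 : (0 : E) ∈ Ω) (hf : ConvexOn ℝ Ω f) (hf0 : f 0 = 0)
    (hd : HasFDerivAt f (0 : E →L[ℝ] ℝ) 0) : ∀ x ∈ Ω, 0 ≤ f x := by
  intro x hx
  have hg : HasDerivAt (fun t : ℝ => t • x) x 0 := by
    simpa using (hasDerivAt_id (0 : ℝ)).smul_const x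
  have hd' : HasFDerivAt f (0 : E →L[ℝ] ℝ) ((0 : ℝ) • x) := by simpa using hd
  have hc := (hd'.comp_hasDerivAt (0 : ℝ) hg).tendsto_slope_zero_right
  simp only [Function.comp, zero_add, zero_smul, hf0, sub_zero,
    ContinuousLinearMap.zero_apply, smul_eq_mul] at hc
  refine le_of_tendsto hc ?_
  filter_upwards [Ioo_mem_nhdsGT (show (0 : ℝ) < 1 by norm_num)] with t ht
  have := (s5_scale h0 hf hf0 hx ht.1.le ht.2.le).2
  rw [inv_mul_le_iff₀ ht.1]
  exact this

theorem s5_dyadic (d ℓ : ℕ) (y lam : ℝ) (hy : 0 ≤ y) (hl : 0 < lam) :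
    ∃ n : ℕ, lam * y < 2 ^ n ∧ y ^ ℓ / (1 + lam * y) ^ (d + ℓ + 1) ≤
      lam⁻¹ ^ ℓ * (2 ^ (d + 1) * (2⁻¹ : ℝ) ^ (n * (d + 1))) := by
  have hex : ∃ n : ℕ, lam * y < 2 ^ n := pow_unbounded_of_one_lt _ (by norm_num)
  have ht : 0 ≤ lam * y := by positivity
  classical
  refine ⟨Nat.find hex, Nat.find_spec hex, ?_⟩
  have hlow : (2 : ℝ) ^ (Nat.find hex) ≤ 2 * (1 + lam * y) := by
    rcases hn : Nat.find hex with _ | m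
    · simp; linarith
    · have := Nat.find_min hex (m := m) (by omega)
      rw [pow_succ]; linarith
  set n := Nat.find hex
  have hp : 0 < 1 + lam * y := by linarith
  have hA : y ^ ℓ ≤ lam⁻¹ ^ ℓ * (1 + lam * y) ^ ℓ := by
    rw [← mul_pow]
    gcongr
    rw [mul_add, inv_mul_cancel_left₀ hl.ne']
    have : 0 < lam⁻¹ * 1 := by positivity
    linarith
  have hB : 1 ≤ (2 ^ (d + 1) * (2⁻¹ : ℝ) ^ (n * (d + 1))) * (1 + lam * y) ^ (d + 1) := by
    rw [pow_mul, ← mul_pow, ← mul_pow]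
    apply one_le_pow₀
    rw [inv_pow, mul_right_comm, ← div_eq_mul_inv, le_div_iff₀ (by positivity)]
    linarith
  rw [div_le_iff₀ (by positivity)]
  calc y ^ ℓ ≤ (lam⁻¹ ^ ℓ * (1 + lam * y) ^ ℓ) * 1 := by simpa using hA
    _ ≤ (lam⁻¹ ^ ℓ * (1 + lam * y) ^ ℓ) *
        ((2 ^ (d + 1) * (2⁻¹ : ℝ) ^ (n * (d + 1))) * (1 + lam * y) ^ (d + 1)) := by gcongr
    _ = _ := by ring

/-- for a convex `f` on an open convex `Ω ∋ 0` with `f(0) = 0`,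
`∇f(0) = 0` (so `f ≥ 0` on `Ω`), every `λ > 0` and every `ℓ ≥ 0`,
`∫_Ω f^ℓ / (1 + λ f)^{d+ℓ+1} ≤ C λ^{-ℓ} · Leb{x ∈ Ω : f(x) < λ⁻¹}`,
with `C` depending only on `d` and `ℓ`.  (Stated with the lower Lebesgue
integral, in `ℝ≥0∞`, so that both sides make sense even when the sublevel set
has infinite measure.) -/
theorem statement_5 (d ℓ : ℕ) :
    ∃ C : ℝ≥0∞, 0 < C ∧ C < ⊤ ∧
      ∀ (Ω : Set (EuclideanSpace ℝ (Fin d))) (f : EuclideanSpace ℝ (Fin d) → ℝ),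
        IsOpen Ω → Convex ℝ Ω → (0 : EuclideanSpace ℝ (Fin d)) ∈ Ω →
        ConvexOn ℝ Ω f → f 0 = 0 →
        HasFDerivAt f (0 : EuclideanSpace ℝ (Fin d) →L[ℝ] ℝ) 0 →
        ∀ lam : ℝ, 0 < lam →
          (∫⁻ x in Ω,
              ENNReal.ofReal (f x ^ ℓ / (1 + lam * f x) ^ (d + ℓ + 1))) ≤
            C * ENNReal.ofReal (lam⁻¹ ^ ℓ) *
              volume {x ∈ Ω | f x < lam⁻¹} := by
  refine ⟨2 ^ (d + 2), by positivity, by finiteness, ?_⟩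
  intro Ω f hO hC h0 hf hf0 hd lam hl
  have hnn := s5_nonneg h0 hf hf0 hd
  set S : ℕ → Set (EuclideanSpace ℝ (Fin d)) := fun n => {x ∈ Ω | lam * f x < 2 ^ n} with hS
  have hSm : ∀ n, MeasurableSet (S n) := by
    intro n
    have hc : ContinuousOn (fun x => lam * f x) Ω :=
      (hf.continuousOn hO).const_mul lam |>.congr (fun _ _ => rfl)
    exact (hc.isOpen_inter_preimage hO (isOpen_Iio (a := (2 : ℝ) ^ n))).measurableSet
  have hS0 : {x ∈ Ω | f x < lam⁻¹} = S 0 := by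
    ext x
    simp only [hS, mem_setOf_eq, pow_zero]
    rw [← one_div, lt_div_iff₀' hl]
  have hvol : ∀ n, volume (S n) ≤ 2 ^ (n * d) * volume (S 0) := by
    intro n
    have hsub : S n ⊆ ((2 : ℝ) ^ n) • S 0 := by
      rintro x ⟨hx, hxn⟩
      have h2 : (0 : ℝ) < 2 ^ n := by positivity
      have h1 : ((2 : ℝ) ^ n)⁻¹ ≤ 1 := inv_le_one_of_one_le₀ (one_le_pow₀ (by norm_num))
      rw [mem_smul_set_iff_inv_smul_mem₀ h2.ne']
      have hm := s5_scale h0 hf hf0 hx (inv_nonneg.2 h2.le) h1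
      refine ⟨hm.1, ?_⟩
      calc lam * f (((2 : ℝ) ^ n)⁻¹ • x) ≤ lam * (((2 : ℝ) ^ n)⁻¹ * f x) := by
            gcongr; exact hm.2
        _ = ((2 : ℝ) ^ n)⁻¹ * (lam * f x) := by ring
        _ < ((2 : ℝ) ^ n)⁻¹ * 2 ^ n := by gcongr
        _ = 2 ^ 0 := by rw [inv_mul_cancel₀ h2.ne', pow_zero]
    refine (measure_mono hsub).trans ?_
    rw [Measure.addHaar_smul, finrank_euclideanSpace_fin, abs_of_nonneg (by positivity), ← pow_mul,
      ENNReal.ofReal_pow (by norm_num)]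
    simp
  have hpt : ∀ x ∈ Ω, ENNReal.ofReal (f x ^ ℓ / (1 + lam * f x) ^ (d + ℓ + 1)) ≤
      ∑' n, (S n).indicator (fun _ => ENNReal.ofReal (lam⁻¹ ^ ℓ) *
        (2 ^ (d + 1) * (2⁻¹ : ℝ≥0∞) ^ (n * (d + 1)))) x := by
    intro x hx
    obtain ⟨n, hxn, hn⟩ := s5_dyadic d ℓ (f x) lam (hnn x hx) hl
    refine le_trans ?_ (ENNReal.le_tsum n)
    rw [indicator_of_mem (show x ∈ S n from ⟨hx, hxn⟩)]
    refine (ENNReal.ofReal_le_ofReal hn).trans (le_of_eq ?_)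
    rw [ENNReal.ofReal_mul (by positivity), ENNReal.ofReal_mul (by positivity),
      ENNReal.ofReal_pow (p := 2) (by norm_num), ENNReal.ofReal_pow (p := 2⁻¹) (by norm_num),
      ENNReal.ofReal_inv_of_pos (x := 2) (by norm_num)]
    simp
  rw [hS0]
  calc _ ≤ ∫⁻ x in Ω, ∑' n, (S n).indicator (fun _ => ENNReal.ofReal (lam⁻¹ ^ ℓ) *
        (2 ^ (d + 1) * (2⁻¹ : ℝ≥0∞) ^ (n * (d + 1)))) x :=
        setLIntegral_mono' hO.measurableSet hpt
    _ = ∑' n, (ENNReal.ofReal (lam⁻¹ ^ ℓ) * (2 ^ (d + 1) * (2⁻¹ : ℝ≥0∞) ^ (n * (d + 1)))) *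
          volume.restrict Ω (S n) := by
        rw [lintegral_tsum (fun n => (measurable_const.indicator (hSm n)).aemeasurable)]
        exact tsum_congr fun n => lintegral_indicator_const (hSm n) _
    _ ≤ ∑' n : ℕ, (ENNReal.ofReal (lam⁻¹ ^ ℓ) * 2 ^ (d + 1) * volume (S 0)) * (2⁻¹ : ℝ≥0∞) ^ n := by
        refine ENNReal.tsum_le_tsum fun n => ?_
        have e : (2⁻¹ : ℝ≥0∞) ^ (n * (d + 1)) * 2 ^ (n * d) = 2⁻¹ ^ n := by
          rw [Nat.mul_succ, add_comm, pow_add, mul_assoc, ← mul_pow,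
            ENNReal.inv_mul_cancel (by norm_num) (by norm_num), one_pow, mul_one]
        calc _ ≤ (ENNReal.ofReal (lam⁻¹ ^ ℓ) * (2 ^ (d + 1) * (2⁻¹ : ℝ≥0∞) ^ (n * (d + 1)))) *
              (2 ^ (n * d) * volume (S 0)) := by
              gcongr
              exact (Measure.restrict_apply_le _ _).trans (hvol n)
          _ = (ENNReal.ofReal (lam⁻¹ ^ ℓ) * 2 ^ (d + 1) * volume (S 0)) *
              ((2⁻¹ : ℝ≥0∞) ^ (n * (d + 1)) * 2 ^ (n * d)) := by ring
          _ ≤ _ := by rw [e]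
    _ = _ := by
        rw [ENNReal.tsum_mul_left, ENNReal.tsum_geometric, ENNReal.one_sub_inv_two, inv_inv]
        ring
end
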